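/- arXiv:1501.02831 — 4 statements merged into one kernel-verified Lean document; each statement's English description precedes it below -/
import Mathlib

section
/- Fix ω > 0, β > 0, M > 0, and let φ : (0,ω) → ℝ be a bounded measurable function. Let v be a measurable kernel on {(x,t) : 0 ≤ t ≤ x ≤ ω} with |v(x,t)| ≤ M·(x−t)^{β−1}, and let T be the bounded operator on L²(0,ω) given by (Tf)(x) = φ(x)f(x) + ∫₀ˣ v(x,t) f(t) dt. Then there exist constants C > 0 and δ > 0 such that for every λ ∈ ℂ with 0 < |Im λ| ≤ δ, the operator T − λI is invertible and ln‖(T − λI)⁻¹‖ ≤ C·|Im λ|^{−1/β}·|ln |Im λ||. -/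
open MeasureTheory Set

open scoped ENNReal

/-- Cauchy–Schwarz for `∫⁻ k F`, splitting the weight `k` evenly. -/
lemma lintegral_mul_sq_le {α : Type*} [MeasurableSpace α] {μ : Measure α} {k F : α → ℝ≥0∞}
    (hk : Measurable k) (hF : Measurable F) :
    (∫⁻ t, k t * F t ∂μ) ^ (2 : ℝ) ≤ (∫⁻ t, k t ∂μ) * ∫⁻ t, k t * F t ^ (2 : ℝ) ∂μ := by
  have hsplit : ∀ a : ℝ≥0∞, a ^ (1 / 2 : ℝ) * a ^ (1 / 2 : ℝ) = a := fun a => by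
    rw [← ENNReal.rpow_add_of_nonneg _ _ (by norm_num) (by norm_num)]; norm_num
  have hsq : ∀ a : ℝ≥0∞, (a ^ (1 / 2 : ℝ)) ^ (2 : ℝ) = a := fun a => by
    rw [← ENNReal.rpow_mul]; norm_num
  have key := ENNReal.lintegral_mul_le_Lp_mul_Lq μ Real.HolderConjugate.two_two
    (hk.pow_const (1 / 2 : ℝ)).aemeasurable ((hk.pow_const (1 / 2 : ℝ)).mul hF).aemeasurable
  simp only [Pi.mul_apply, ← mul_assoc, hsplit, ENNReal.mul_rpow_of_nonneg _ _ zero_le_two,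
    hsq] at key
  refine (ENNReal.rpow_le_rpow key zero_le_two).trans_eq ?_
  rw [ENNReal.mul_rpow_of_nonneg _ _ zero_le_two, hsq, hsq]

/-- The `L¹ * L² → L²` case of Young's convolution inequality, for nonnegative functions. -/
lemma lintegral_convolution_sq_le {k F : ℝ → ℝ≥0∞} (hk : Measurable k) (hF : Measurable F) :
    ∫⁻ x, (∫⁻ t, k (x - t) * F t) ^ (2 : ℝ) ≤
      (∫⁻ t, k t) ^ (2 : ℝ) * ∫⁻ t, F t ^ (2 : ℝ) := by
  have hmeas : Measurable (Function.uncurry fun x t : ℝ => k (x - t) * F t ^ (2 : ℝ)) := by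
    unfold Function.uncurry; fun_prop
  calc ∫⁻ x, (∫⁻ t, k (x - t) * F t) ^ (2 : ℝ)
      ≤ ∫⁻ x, (∫⁻ t, k t) * ∫⁻ t, k (x - t) * F t ^ (2 : ℝ) := by
        refine lintegral_mono fun x => ?_
        refine (lintegral_mul_sq_le (k := fun t => k (x - t)) (by fun_prop) hF).trans_eq ?_
        rw [lintegral_sub_left_eq_self k x]
    _ = (∫⁻ t, k t) * ∫⁻ x, ∫⁻ t, k (x - t) * F t ^ (2 : ℝ) :=
        lintegral_const_mul _ hmeas.lintegral_prod_right
    _ = (∫⁻ t, k t) * ∫⁻ t, ∫⁻ x, k (x - t) * F t ^ (2 : ℝ) := by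
        rw [lintegral_lintegral_swap hmeas.aemeasurable]
    _ = (∫⁻ t, k t) * ∫⁻ t, (∫⁻ x, k x) * F t ^ (2 : ℝ) := by
        congr 1
        refine lintegral_congr fun t => ?_
        rw [lintegral_mul_const _ (by fun_prop), lintegral_sub_right_eq_self k t]
    _ = (∫⁻ t, k t) ^ (2 : ℝ) * ∫⁻ t, F t ^ (2 : ℝ) := by
        rw [lintegral_const_mul _ (by fun_prop), ← mul_assoc, ENNReal.rpow_two, sq]

/-- If `‖A f‖` is dominated pointwise by the convolution of `k` with `‖f‖`, then
`‖A‖` is at most the integral of `k`. -/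
lemma opNorm_le_of_ae_le_convolution {s : Set ℝ} (hs : MeasurableSet s) {k : ℝ → ℝ≥0∞}
    (hk : Measurable k) {κ : ℝ} (hκ : 0 ≤ κ) (hkκ : ∫⁻ t, k t ≤ ENNReal.ofReal κ)
    (A : Lp ℂ 2 (volume.restrict s) →L[ℂ] Lp ℂ 2 (volume.restrict s))
    (hA : ∀ f : Lp ℂ 2 (volume.restrict s), ∀ᵐ x ∂(volume.restrict s),
      ‖A f x‖ₑ ≤ ∫⁻ t in s, k (x - t) * ‖f t‖ₑ) :
    ‖A‖ ≤ κ := by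
  refine A.opNorm_le_bound hκ fun f => ?_
  have hfm : Measurable (f : ℝ → ℂ) := (Lp.stronglyMeasurable f).measurable
  have hpow : ∀ g : ℝ → ℂ, eLpNorm g 2 (volume.restrict s) ^ (2 : ℝ) =
      ∫⁻ x in s, ‖g x‖ₑ ^ (2 : ℝ) := fun g =>
    eLpNorm_nnreal_pow_eq_lintegral (p := 2) two_ne_zero
  have hind : ∀ t, s.indicator (fun t => ‖f t‖ₑ) t ^ (2 : ℝ) =
      s.indicator (fun t => ‖f t‖ₑ ^ (2 : ℝ)) t := fun t => by
    by_cases ht : t ∈ s <;> simp [ht]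
  have h_sq : eLpNorm (A f) 2 (volume.restrict s) ^ (2 : ℝ) ≤
      (ENNReal.ofReal κ * eLpNorm f 2 (volume.restrict s)) ^ (2 : ℝ) := by
    rw [ENNReal.mul_rpow_of_nonneg _ _ zero_le_two, hpow, hpow]
    calc ∫⁻ x in s, ‖A f x‖ₑ ^ (2 : ℝ)
        ≤ ∫⁻ x in s, (∫⁻ t, k (x - t) * s.indicator (fun t => ‖f t‖ₑ) t) ^ (2 : ℝ) := by
          refine lintegral_mono_ae ?_
          filter_upwards [hA f] with x hx
          refine ENNReal.rpow_le_rpow (hx.trans_eq ?_) zero_le_two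
          rw [← lintegral_indicator hs]
          refine lintegral_congr fun t => ?_
          by_cases ht : t ∈ s <;> simp [ht]
      _ ≤ ∫⁻ x, (∫⁻ t, k (x - t) * s.indicator (fun t => ‖f t‖ₑ) t) ^ (2 : ℝ) :=
          setLIntegral_le_lintegral _ _
      _ ≤ (∫⁻ t, k t) ^ (2 : ℝ) * ∫⁻ t, s.indicator (fun t => ‖f t‖ₑ) t ^ (2 : ℝ) :=
          lintegral_convolution_sq_le hk (hfm.enorm.indicator hs)
      _ ≤ ENNReal.ofReal κ ^ (2 : ℝ) * ∫⁻ t in s, ‖f t‖ₑ ^ (2 : ℝ) := by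
          simp only [hind]
          rw [lintegral_indicator hs]
          gcongr
  have hle := (ENNReal.rpow_le_rpow_iff zero_lt_two).1 h_sq
  have := ENNReal.toReal_mono (ENNReal.mul_ne_top ENNReal.ofReal_ne_top (Lp.eLpNorm_ne_top f)) hle
  rwa [ENNReal.toReal_mul, ENNReal.toReal_ofReal hκ, ← Lp.norm_def, ← Lp.norm_def] at this

/-- Multiplication by an essentially bounded function is a bounded operator on `L²`. -/
lemma exists_mulCLM {α : Type*} [MeasurableSpace α] {μ : Measure α} {g : α → ℂ}
    (hg : AEStronglyMeasurable g μ) {c : ℝ} (hc : 0 ≤ c) (hgc : ∀ᵐ x ∂μ, ‖g x‖ ≤ c) :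
    ∃ A : Lp ℂ 2 μ →L[ℂ] Lp ℂ 2 μ, ‖A‖ ≤ c ∧ ∀ f, A f =ᵐ[μ] fun x => g x * f x := by
  have hmem : ∀ f : Lp ℂ 2 μ, MemLp (fun x => g x * f x) 2 μ := fun f =>
    (Lp.memLp f).of_le_mul (c := c) (hg.mul (Lp.aestronglyMeasurable f)) <| by
      filter_upwards [hgc] with x hx
      rw [norm_mul]
      gcongr
  have hcoe : ∀ f, ((hmem f).toLp _) =ᵐ[μ] fun x => g x * f x := fun f => (hmem f).coeFn_toLp
  refine ⟨LinearMap.mkContinuous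
    { toFun := fun f => ((hmem f).toLp _)
      map_add' := fun f₁ f₂ => ?_
      map_smul' := fun a f => ?_ } c fun f => ?_, LinearMap.mkContinuous_norm_le _ hc _, hcoe⟩
  · refine Lp.ext ?_
    filter_upwards [hcoe (f₁ + f₂), hcoe f₁, hcoe f₂, Lp.coeFn_add f₁ f₂,
      Lp.coeFn_add (hmem f₁).toLp (hmem f₂).toLp] with x h h₁ h₂ h₃ h₄
    rw [h, h₄, Pi.add_apply, h₁, h₂, h₃, Pi.add_apply, mul_add]
  · refine Lp.ext ?_
    filter_upwards [hcoe (a • f), hcoe f, Lp.coeFn_smul a f,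
      Lp.coeFn_smul a ((hmem f).toLp _)] with x h h₁ h₂ h₃
    rw [h, RingHom.id_apply, h₃, Pi.smul_apply, h₁, h₂, Pi.smul_apply, smul_eq_mul, smul_eq_mul,
      mul_left_comm]
  · refine Lp.norm_le_mul_norm_of_ae_le_mul ?_
    filter_upwards [hcoe f, hgc] with x h hx
    change ‖((hmem f).toLp _) x‖ ≤ _
    rw [h, norm_mul]
    gcongr

lemma mul_eq_one_of_ae_mul {α : Type*} [MeasurableSpace α] {μ : Measure α} {g g' : α → ℂ}
    {A A' : Lp ℂ 2 μ →L[ℂ] Lp ℂ 2 μ} (hA : ∀ f, A f =ᵐ[μ] fun x => g x * f x)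
    (hA' : ∀ f, A' f =ᵐ[μ] fun x => g' x * f x) (h : ∀ x, g x * g' x = 1) : A * A' = 1 := by
  ext1 f
  refine Lp.ext ?_
  filter_upwards [hA (A' f), hA' f] with x h₁ h₂
  change A (A' f) x = f x
  rw [h₁, h₂, ← mul_assoc, h, one_mul]

/-- Invertibility of an element similar to a small relative perturbation of a unit. -/
lemma isUnit_and_norm_inverse_le_of_conj {R : Type*} [NormedRing R] [CompleteSpace R]
    (hone : ‖(1 : R)‖ ≤ 1) {A D D' E E' : R} (hDD' : D * D' = 1) (hD'D : D' * D = 1)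
    (hEE' : E * E' = 1) (hE'E : E' * E = 1) (hsmall : ‖D' * (E' * A * E - D)‖ ≤ 1 / 2) :
    IsUnit A ∧ ‖Ring.inverse A‖ ≤ ‖E‖ * 2 * ‖D'‖ * ‖E'‖ := by
  set X := D' * (E' * A * E - D) with hX
  obtain ⟨u, hu⟩ : IsUnit (1 + X) := by
    have := isUnit_one_sub_of_norm_lt_one (x := -X) (by rw [norm_neg]; linarith)
    rwa [sub_neg_eq_add] at this
  have hA : A = E * D * u * E' := by
    have h₁ : D * (1 + X) = E' * A * E := by
      rw [hX, mul_add, ← mul_assoc, hDD']; noncomm_ring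
    calc A = (E * E') * A * (E * E') := by rw [hEE']; simp
      _ = E * (E' * A * E) * E' := by noncomm_ring
      _ = E * D * u * E' := by rw [← h₁, hu]; noncomm_ring
  have hunorm : ‖(↑u⁻¹ : R)‖ ≤ 2 := by
    have h₁ : (↑u⁻¹ : R) = 1 - X * ↑u⁻¹ := by
      have := u.mul_inv
      rw [hu, add_mul, one_mul] at this
      exact eq_sub_of_add_eq this
    have h₂ : ‖(↑u⁻¹ : R)‖ ≤ 1 + 1 / 2 * ‖(↑u⁻¹ : R)‖ := by
      calc ‖(↑u⁻¹ : R)‖ = ‖1 - X * ↑u⁻¹‖ := congrArg _ h₁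
        _ ≤ ‖(1 : R)‖ + ‖X * ↑u⁻¹‖ := norm_sub_le _ _
        _ ≤ 1 + 1 / 2 * ‖(↑u⁻¹ : R)‖ := by
          gcongr
          exact (norm_mul_le _ _).trans (by gcongr)
    linarith
  let w : Rˣ := ⟨E, E', hEE', hE'E⟩ * ⟨D, D', hDD', hD'D⟩ * u * ⟨E', E, hE'E, hEE'⟩
  have hw : A = w := hA
  refine ⟨hw ▸ w.isUnit, ?_⟩
  rw [hw, Ring.inverse_unit]
  have hinv : (↑w⁻¹ : R) = E * (↑u⁻¹ * (D' * E')) := by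
    simp only [w, mul_inv_rev, Units.val_mul]; rfl
  rw [hinv]
  calc ‖E * (↑u⁻¹ * (D' * E'))‖ ≤ ‖E‖ * (‖(↑u⁻¹ : R)‖ * (‖D'‖ * ‖E'‖)) :=
        (norm_mul_le _ _).trans <| by
          gcongr
          exact (norm_mul_le _ _).trans <| by
            gcongr
            exact norm_mul_le _ _
    _ ≤ ‖E‖ * (2 * (‖D'‖ * ‖E'‖)) := by gcongr
    _ = ‖E‖ * 2 * ‖D'‖ * ‖E'‖ := by ring

/-- The exponentially damped weakly singular kernel. -/
noncomputable def dampedKernel (M β s : ℝ) : ℝ → ℝ≥0∞ :=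
  (Ioi (0 : ℝ)).indicator fun u => ENNReal.ofReal (M * (u ^ (β - 1) * Real.exp (-(s * u))))

lemma measurable_dampedKernel (M β s : ℝ) : Measurable (dampedKernel M β s) :=
  Measurable.indicator (by fun_prop) measurableSet_Ioi

lemma lintegral_dampedKernel {M β s : ℝ} (hM : 0 < M) (hβ : 0 < β) (hs : 0 < s) :
    ∫⁻ u, dampedKernel M β s u = ENNReal.ofReal (M * ((1 / s) ^ β * Real.Gamma β)) := by
  have hval := Real.integral_rpow_mul_exp_neg_mul_Ioi hβ hs
  have h_int : IntegrableOn (fun u : ℝ => u ^ (β - 1) * Real.exp (-(s * u))) (Ioi 0) :=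
    .of_integral_ne_zero (by rw [hval]; have := Real.Gamma_pos_of_pos hβ; positivity)
  rw [dampedKernel, lintegral_indicator measurableSet_Ioi, ← hval, ← integral_const_mul,
    ofReal_integral_eq_lintegral_ofReal (h_int.const_mul M)]
  filter_upwards [ae_restrict_mem measurableSet_Ioi] with u hu
  have : (0 : ℝ) < u := hu
  simp only [Pi.zero_apply]
  positivity

/-- A weakly singular Volterra operator conjugated by `exp (s x)` is small for large `s`. -/
lemma enorm_damped_volterra_le {ω M β s x : ℝ} (hM : 0 ≤ M) {v : ℝ → ℝ → ℂ}
    (hv : ∀ x t : ℝ, 0 ≤ t → t < x → x ≤ ω → ‖v x t‖ ≤ M * (x - t) ^ (β - 1))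
    (hx : x ∈ Ioo 0 ω) (f : ℝ → ℂ) :
    ‖(Real.exp (-(s * x)) : ℂ) * ∫ t in Ioo 0 x, v x t * ((Real.exp (s * t) : ℂ) * f t)‖ₑ ≤
      ∫⁻ t in Ioo 0 ω, dampedKernel M β s (x - t) * ‖f t‖ₑ := by
  rw [← integral_const_mul]
  refine (enorm_integral_le_lintegral_enorm _).trans ?_
  refine le_trans ?_ (lintegral_mono_set (Ioo_subset_Ioo_right hx.2.le))
  refine setLIntegral_mono' measurableSet_Ioo fun t ht => ?_
  have hpos : 0 < x - t := sub_pos.2 ht.2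
  rw [dampedKernel, indicator_of_mem (mem_Ioi.2 hpos), ← ofReal_norm, ← ofReal_norm,
    ← ENNReal.ofReal_mul (by positivity)]
  refine ENNReal.ofReal_le_ofReal ?_
  rw [norm_mul, norm_mul, norm_mul, Complex.norm_real, Complex.norm_real, Real.norm_eq_abs,
    Real.norm_eq_abs, Real.abs_exp, Real.abs_exp]
  calc Real.exp (-(s * x)) * (‖v x t‖ * (Real.exp (s * t) * ‖f t‖))
      ≤ Real.exp (-(s * x)) * (M * (x - t) ^ (β - 1) * (Real.exp (s * t) * ‖f t‖)) := by
        gcongr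
        exact hv x t ht.1.le ht.2 hx.2.le
    _ = M * ((x - t) ^ (β - 1) * Real.exp (-(s * (x - t)))) * ‖f t‖ := by
        have : Real.exp (-(s * (x - t))) = Real.exp (-(s * x)) * Real.exp (s * t) := by
          rw [← Real.exp_add]; ring_nf
        rw [this]; ring

/-- Resolvent estimate with a free exponential weight `s`. -/
lemma isUnit_sub_and_norm_inverse_le {ω β M : ℝ} (hβ : 0 < β) (hM : 0 < M)
    {φ : ℝ → ℝ} (hφmeas : Measurable φ) (hφbdd : ∃ K : ℝ, ∀ x ∈ Ioo (0 : ℝ) ω, |φ x| ≤ K)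
    {v : ℝ → ℝ → ℂ}
    (hv : ∀ x t : ℝ, 0 ≤ t → t < x → x ≤ ω → ‖v x t‖ ≤ M * (x - t) ^ (β - 1))
    {T : Lp ℂ 2 (volume.restrict (Ioo 0 ω)) →L[ℂ] Lp ℂ 2 (volume.restrict (Ioo 0 ω))}
    (hT : ∀ f : Lp ℂ 2 (volume.restrict (Ioo 0 ω)),
      (⇑(T f) : ℝ → ℂ) =ᵐ[volume.restrict (Ioo 0 ω)]
        fun x : ℝ => (φ x : ℂ) * f x + ∫ t in Ioo (0 : ℝ) x, v x t * f t)
    {z : ℂ} (hz : 0 < |z.im|) {s : ℝ} (hs : 0 < s)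
    (hsz : M * ((1 / s) ^ β * Real.Gamma β) ≤ |z.im| / 2) :
    IsUnit (T - algebraMap ℂ _ z) ∧
      ‖Ring.inverse (T - algebraMap ℂ _ z)‖ ≤ Real.exp (s * ω) * 2 * |z.im|⁻¹ := by
  obtain ⟨K, hK⟩ := hφbdd
  have hmem := ae_restrict_mem (μ := (volume : Measure ℝ)) (measurableSet_Ioo (a := 0) (b := ω))
  have him : ∀ x, |z.im| ≤ ‖(φ x : ℂ) - z‖ := fun x => by
    simpa using Complex.abs_im_le_norm ((φ x : ℂ) - z)
  have hne : ∀ x, (φ x : ℂ) - z ≠ 0 := fun x => norm_pos_iff.1 (hz.trans_le (him x))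
  obtain ⟨D, -, hD⟩ := exists_mulCLM (μ := volume.restrict (Ioo 0 ω))
    (g := fun x => (φ x : ℂ) - z) (by fun_prop) (c := |K| + ‖z‖) (by positivity) (by
      filter_upwards [hmem] with x hx
      refine (norm_sub_le _ _).trans ?_
      gcongr
      rw [Complex.norm_real, Real.norm_eq_abs]
      exact (hK x hx).trans (le_abs_self K))
  obtain ⟨D', hD'n, hD'⟩ := exists_mulCLM (μ := volume.restrict (Ioo 0 ω))
    (g := fun x => ((φ x : ℂ) - z)⁻¹) (Measurable.aestronglyMeasurable (by fun_prop))
    (c := |z.im|⁻¹) (by positivity) (by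
      refine .of_forall fun x => ?_
      rw [norm_inv]
      exact inv_anti₀ hz (him x))
  obtain ⟨E, hEn, hE⟩ := exists_mulCLM (μ := volume.restrict (Ioo 0 ω))
    (g := fun x => (Real.exp (s * x) : ℂ)) (Measurable.aestronglyMeasurable (by fun_prop))
    (c := Real.exp (s * ω)) (by positivity) (by
      filter_upwards [hmem] with x hx
      rw [Complex.norm_real, Real.norm_eq_abs, Real.abs_exp]
      gcongr
      exact hx.2.le)
  obtain ⟨E', hE'n, hE'⟩ := exists_mulCLM (μ := volume.restrict (Ioo 0 ω))
    (g := fun x => (Real.exp (-(s * x)) : ℂ)) (Measurable.aestronglyMeasurable (by fun_prop))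
    (c := 1) zero_le_one (by
      filter_upwards [hmem] with x hx
      rw [Complex.norm_real, Real.norm_eq_abs, Real.abs_exp, Real.exp_le_one_iff]
      have := hx.1
      exact neg_nonpos.2 (by positivity))
  have hexp : ∀ x : ℝ, (Real.exp (s * x) : ℂ) * (Real.exp (-(s * x)) : ℂ) = 1 := fun x => by
    rw [← Complex.ofReal_mul, ← Real.exp_add]; simp
  have hW : ‖E' * (T - algebraMap ℂ _ z) * E - D‖ ≤ M * ((1 / s) ^ β * Real.Gamma β) := by
    have hΓ := Real.Gamma_pos_of_pos hβ
    refine opNorm_le_of_ae_le_convolution measurableSet_Ioo (measurable_dampedKernel M β s)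
      (by positivity) (lintegral_dampedKernel hM hβ hs).le _ fun f => ?_
    filter_upwards [hmem, hE f, hE' ((T - algebraMap ℂ _ z) (E f)), hT (E f), hD f,
      Lp.coeFn_sub (T (E f)) (z • E f), Lp.coeFn_smul z (E f),
      Lp.coeFn_sub (E' ((T - algebraMap ℂ _ z) (E f))) (D f)] with x hx h₁ h₂ h₃ h₄ h₅ h₆ h₇
    have h_int : ∫ t in Ioo 0 x, v x t * E f t =
        ∫ t in Ioo 0 x, v x t * ((Real.exp (s * t) : ℂ) * f t) := by
      refine integral_congr_ae ?_
      filter_upwards [ae_restrict_of_ae_restrict_of_subset (Ioo_subset_Ioo_right hx.2.le) (hE f)]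
        with t ht
      rw [ht]
    have hval : (E' * (T - algebraMap ℂ _ z) * E - D) f x =
        (Real.exp (-(s * x)) : ℂ) *
          ∫ t in Ioo 0 x, v x t * ((Real.exp (s * t) : ℂ) * f t) := by
      change (E' ((T - algebraMap ℂ _ z) (E f)) - D f : Lp ℂ 2 _) x = _
      rw [h₇, Pi.sub_apply, h₂, h₄]
      change _ * (T (E f) - z • E f : Lp ℂ 2 _) x - _ = _
      rw [h₅, Pi.sub_apply, h₃, h₆, Pi.smul_apply, smul_eq_mul, h₁, h_int]
      linear_combination ((φ x : ℂ) - z) * f x * hexp x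
    rw [hval]
    exact enorm_damped_volterra_le hM.le hv hx f
  obtain ⟨hu, hn⟩ := isUnit_and_norm_inverse_le_of_conj (A := T - algebraMap ℂ _ z)
    ContinuousLinearMap.norm_id_le
    (mul_eq_one_of_ae_mul hD hD' fun x => mul_inv_cancel₀ (hne x))
    (mul_eq_one_of_ae_mul hD' hD fun x => inv_mul_cancel₀ (hne x))
    (mul_eq_one_of_ae_mul hE hE' hexp)
    (mul_eq_one_of_ae_mul hE' hE fun x => (mul_comm _ _).trans (hexp x)) (by
      calc ‖D' * (E' * (T - algebraMap ℂ _ z) * E - D)‖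
          ≤ ‖D'‖ * ‖E' * (T - algebraMap ℂ _ z) * E - D‖ := norm_mul_le _ _
        _ ≤ |z.im|⁻¹ * (|z.im| / 2) := by gcongr; exact hW.trans hsz
        _ = 1 / 2 := by field_simp)
  refine ⟨hu, hn.trans ?_⟩
  calc ‖E‖ * 2 * ‖D'‖ * ‖E'‖ ≤ Real.exp (s * ω) * 2 * |z.im|⁻¹ * 1 := by gcongr
    _ = _ := mul_one _



theorem stmt_8 (ω : ℝ) (hω : 0 < ω) (β : ℝ) (hβ : 0 < β) (M : ℝ) (hM : 0 < M)
    (φ : ℝ → ℝ) (hφmeas : Measurable φ) (hφbdd : ∃ K : ℝ, ∀ x ∈ Ioo (0 : ℝ) ω, |φ x| ≤ K)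
    (v : ℝ → ℝ → ℂ) (hvmeas : Measurable (Function.uncurry v))
    (hv : ∀ x t : ℝ, 0 ≤ t → t < x → x ≤ ω → ‖v x t‖ ≤ M * (x - t) ^ (β - 1))
    (T : Lp ℂ 2 (volume.restrict (Ioo 0 ω)) →L[ℂ] Lp ℂ 2 (volume.restrict (Ioo 0 ω)))
    (hT : ∀ f : Lp ℂ 2 (volume.restrict (Ioo 0 ω)),
      (⇑(T f) : ℝ → ℂ) =ᵐ[volume.restrict (Ioo 0 ω)]
        fun x : ℝ => (φ x : ℂ) * f x + ∫ t in Ioo (0 : ℝ) x, v x t * f t) :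
    ∃ C > (0 : ℝ), ∃ δ > (0 : ℝ), ∀ z : ℂ, 0 < |z.im| → |z.im| ≤ δ →
      IsUnit (T - algebraMap ℂ (Lp ℂ 2 (volume.restrict (Ioo 0 ω)) →L[ℂ] Lp ℂ 2 (volume.restrict (Ioo 0 ω))) z) ∧
      Real.log ‖Ring.inverse (T - algebraMap ℂ (Lp ℂ 2 (volume.restrict (Ioo 0 ω)) →L[ℂ] Lp ℂ 2 (volume.restrict (Ioo 0 ω))) z)‖ ≤
        C * |z.im| ^ (-(1 : ℝ) / β) * abs (Real.log (abs z.im)) := by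

  have hΓ := Real.Gamma_pos_of_pos hβ
  set c : ℝ := (2 * M * Real.Gamma β) ^ (1 / β) with hc
  have hcpos : 0 < c := by positivity
  refine ⟨c * ω + 2, by positivity, Real.exp (-1), Real.exp_pos _, fun z hz hzδ => ?_⟩
  set h := |z.im|
  have hlog : Real.log h ≤ -1 := by
    rw [← Real.log_exp (-1)]
    exact Real.log_le_log hz hzδ
  have habs : |Real.log h| = -Real.log h := abs_of_neg (by linarith)
  have hh1 : h ≤ 1 := hzδ.trans (Real.exp_le_one_iff.2 (by norm_num))
  have hP : 1 ≤ h ^ (-(1 : ℝ) / β) :=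
    Real.one_le_rpow_of_pos_of_le_one_of_nonpos hz hh1
      (div_nonpos_of_nonpos_of_nonneg (by norm_num) hβ.le)
  set P := h ^ (-(1 : ℝ) / β) with hPdef
  have hspow : (1 / (c * P)) ^ β = h / (2 * M * Real.Gamma β) := by
    rw [one_div, Real.inv_rpow (by positivity), Real.mul_rpow (by positivity) (by positivity), hc,
      hPdef, ← Real.rpow_mul (by positivity), ← Real.rpow_mul hz.le, one_div_mul_cancel hβ.ne',
      div_mul_cancel₀ _ hβ.ne', Real.rpow_one, Real.rpow_neg_one]
    field_simp
  obtain ⟨hu, hn⟩ := isUnit_sub_and_norm_inverse_le hβ hM hφmeas hφbdd hv hT hz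
    (s := c * P) (by positivity) (le_of_eq (by rw [hspow]; field_simp; rfl))
  refine ⟨hu, ?_⟩
  have hB : Real.log (Real.exp (c * P * ω) * 2 * h⁻¹) = c * P * ω + Real.log 2 - Real.log h := by
    rw [Real.log_mul (by positivity) (by positivity), Real.log_mul (by positivity) (by positivity),
      Real.log_exp, Real.log_inv]
    ring
  have hlog2 : 0 < Real.log 2 := Real.log_pos (by norm_num)
  have hlog2' : Real.log 2 ≤ 1 := by linarith [Real.log_two_lt_d9]
  have hle : c * P * ω + Real.log 2 - Real.log h ≤ (c * ω + 2) * P * |Real.log h| := by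
    rw [habs]
    have h₁ : P ≤ P * -Real.log h := le_mul_of_one_le_right (by linarith) (by linarith)
    have h₂ : -Real.log h ≤ P * -Real.log h := le_mul_of_one_le_left (by linarith) hP
    have h₃ : c * ω * P ≤ c * ω * (P * -Real.log h) := by gcongr
    linarith
  refine le_trans ?_ hle
  rcases (norm_nonneg (Ring.inverse (T - algebraMap ℂ _ z))).eq_or_lt' with h0 | h0
  · rw [h0, Real.log_zero]
    have : 0 ≤ c * P * ω := by positivity
    linarith
  · rw [← hB]
    exact Real.log_le_log h0 hn
end

section
/- Fix a real constant C and define E_β(x) = ∫₀^∞ (1/Γ(s)) e^{−Cs} s^{β−1} x^{s−1} ds for β > 0 and x > 0. Then for all α > 0, β > 0 and all x > 0: ∫₀ˣ E_α(x−y)·E_β(y) dy = (Γ(α)Γ(β)/Γ(α+β))·E_{α+β}(x). Equivalently, the convolution operators V_β f(x) = (1/Γ(β)) ∫₀ˣ E_β(x−t) f(t) dt on L²(0,ω) form a semigroup: V_α V_β = V_{α+β}. -/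
open MeasureTheory Set

open scoped ENNReal Convolution

theorem setLIntegral_beta_kernel {s r x : ℝ} (hs : 0 < s) (hr : 0 < r) (hx : 0 < x) :
    ∫⁻ y in Ioo 0 x, ENNReal.ofReal ((x - y) ^ (s - 1) * y ^ (r - 1)) =
      ENNReal.ofReal (x ^ (s + r - 1) * (Real.Gamma s * Real.Gamma r / Real.Gamma (s + r))) := by
  have hB : 0 < ProbabilityTheory.beta r s := ProbabilityTheory.beta_pos hr hs
  have h1 : ∫⁻ y in Ioo (0 : ℝ) 1, ENNReal.ofReal ((1 - y) ^ (s - 1) * y ^ (r - 1)) =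
      ENNReal.ofReal (ProbabilityTheory.beta r s) := by
    have h := ProbabilityTheory.lintegral_betaPDF_eq_one hr hs
    rw [ProbabilityTheory.lintegral_betaPDF] at h
    have h2 : ∀ y : ℝ, ENNReal.ofReal
        (1 / ProbabilityTheory.beta r s * y ^ (r - 1) * (1 - y) ^ (s - 1)) =
        ENNReal.ofReal (1 / ProbabilityTheory.beta r s) *
          ENNReal.ofReal ((1 - y) ^ (s - 1) * y ^ (r - 1)) := by
      intro y
      rw [← ENNReal.ofReal_mul (by positivity)]
      ring_nf
    simp_rw [h2] at h
    rw [lintegral_const_mul _ (by fun_prop), one_div, ENNReal.ofReal_inv_of_pos hB] at h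
    rw [ENNReal.eq_inv_of_mul_eq_one_left ((mul_comm _ _).trans h), inv_inv]
  have himg : Ioo 0 x = (fun z => x * z) '' Ioo (0 : ℝ) 1 := by
    rw [Set.image_mul_left_Ioo hx]; simp
  have h3 := lintegral_image_eq_lintegral_abs_deriv_mul (s := Ioo (0 : ℝ) 1) (f := fun z => x * z)
    (f' := fun _ => x) measurableSet_Ioo
    (fun z _ => by simpa using ((hasDerivAt_id z).const_mul x).hasDerivWithinAt)
    (fun a _ b _ h => mul_left_cancel₀ hx.ne' h)
    (fun y => ENNReal.ofReal ((x - y) ^ (s - 1) * y ^ (r - 1)))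
  rw [himg, h3]
  have h4 : ∀ z ∈ Ioo (0 : ℝ) 1, ENNReal.ofReal |x| *
      ENNReal.ofReal ((x - x * z) ^ (s - 1) * (x * z) ^ (r - 1)) =
      ENNReal.ofReal (x ^ (s + r - 1)) * ENNReal.ofReal ((1 - z) ^ (s - 1) * z ^ (r - 1)) := by
    intro z hz
    rw [← ENNReal.ofReal_mul (abs_nonneg _), ← ENNReal.ofReal_mul (by positivity),
      abs_of_pos hx, show x - x * z = x * (1 - z) by ring,
      Real.mul_rpow hx.le (by linarith [hz.2]), Real.mul_rpow hx.le hz.1.le,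
      show s + r - 1 = 1 + (s - 1) + (r - 1) by ring, Real.rpow_add hx, Real.rpow_add hx,
      Real.rpow_one]
    ring_nf
  rw [setLIntegral_congr_fun measurableSet_Ioo h4, lintegral_const_mul _ (by fun_prop), h1,
    ← ENNReal.ofReal_mul (by positivity)]
  simp only [ProbabilityTheory.beta]
  rw [add_comm r s, mul_comm (Real.Gamma r)]

theorem lintegral_Ioi_Ioi_eq_lintegral_Ioo {φ : ℝ → ℝ → ℝ≥0∞} (hφ : Measurable φ.uncurry) :
    ∫⁻ s in Ioi (0 : ℝ), ∫⁻ r in Ioi (0 : ℝ), φ s r =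
      ∫⁻ u in Ioi (0 : ℝ), ∫⁻ r in Ioo 0 u, φ (u - r) r := by
  have hm : MeasurableSet {p : ℝ × ℝ | 0 < p.2 ∧ p.2 < p.1} :=
    (measurableSet_lt measurable_const measurable_snd).inter
      (measurableSet_lt measurable_snd measurable_fst)
  have hψ : Measurable (fun p : ℝ × ℝ => {p : ℝ × ℝ | 0 < p.2 ∧ p.2 < p.1}.indicator
      (fun p => φ (p.1 - p.2) p.2) p) :=
    (hφ.comp ((measurable_fst.sub measurable_snd).prodMk measurable_snd)).indicator hm
  have hR : ∫⁻ u in Ioi (0 : ℝ), ∫⁻ r in Ioo 0 u, φ (u - r) r =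
      ∫⁻ u, ∫⁻ r, {p : ℝ × ℝ | 0 < p.2 ∧ p.2 < p.1}.indicator
        (fun p => φ (p.1 - p.2) p.2) (u, r) := by
    rw [← lintegral_indicator measurableSet_Ioi]
    congr with u
    by_cases hu : 0 < u
    · rw [indicator_of_mem (show u ∈ Ioi 0 from hu), ← lintegral_indicator measurableSet_Ioo]
      rfl
    · rw [indicator_of_notMem (show u ∉ Ioi 0 from hu)]
      symm
      refine (lintegral_congr fun r => ?_).trans lintegral_zero
      refine indicator_of_notMem ?_ _
      rintro ⟨h1, h2⟩
      exact hu (h1.trans h2)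
  have hS := lintegral_lintegral_swap (μ := volume) (ν := volume) (f := fun u r : ℝ =>
    {p : ℝ × ℝ | 0 < p.2 ∧ p.2 < p.1}.indicator (fun p => φ (p.1 - p.2) p.2) (u, r))
    hψ.aemeasurable
  rw [lintegral_lintegral_swap hφ.aemeasurable, hR, hS,
    ← lintegral_indicator measurableSet_Ioi]
  congr with r
  rw [← lintegral_add_right_eq_self _ r]
  by_cases hr : 0 < r
  · rw [indicator_of_mem (show r ∈ Ioi 0 from hr), ← lintegral_indicator measurableSet_Ioi]
    congr with s
    simp [indicator, hr]
  · rw [indicator_of_notMem (show r ∉ Ioi 0 from hr)]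
    simp [indicator, hr]

/-- The integrand, in the variable `s`, of the kernel `E_β(x)`. -/
noncomputable def volterraKernel (C β x s : ℝ) : ℝ :=
  (1 / Real.Gamma s) * Real.exp (-C * s) * s ^ (β - 1) * x ^ (s - 1)

theorem volterraKernel_nonneg (C β : ℝ) {x s : ℝ} (hx : 0 ≤ x) (hs : 0 < s) :
    0 ≤ volterraKernel C β x s := by
  have := Real.Gamma_pos_of_pos hs
  unfold volterraKernel
  positivity

theorem measurable_Gamma_inv : Measurable fun s : ℝ => 1 / Real.Gamma s := by
  have h : (fun s : ℝ => 1 / Real.Gamma s) = fun s : ℝ => ((Complex.Gamma s)⁻¹).re := by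
    ext s
    rw [Complex.Gamma_ofReal, ← Complex.ofReal_inv, Complex.ofReal_re, one_div]
  rw [h]
  exact (Complex.continuous_re.comp
    (Complex.differentiable_one_div_Gamma.continuous.comp Complex.continuous_ofReal)).measurable

theorem measurable_volterraKernel (C β : ℝ) :
    Measurable fun p : ℝ × ℝ => volterraKernel C β p.1 p.2 := by
  have : Measurable fun p : ℝ × ℝ => 1 / Real.Gamma p.2 :=
    measurable_Gamma_inv.comp measurable_snd
  unfold volterraKernel
  refine ((Measurable.mul this ?_).mul ?_).mul ?_ <;> fun_prop

/-- The kernel `E_β(x)` as an extended nonnegative real. -/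
noncomputable def volterraLIntegral (C β x : ℝ) : ℝ≥0∞ :=
  ∫⁻ s in Ioi (0 : ℝ), ENNReal.ofReal (volterraKernel C β x s)

theorem measurable_volterraLIntegral (C β : ℝ) : Measurable (volterraLIntegral C β) :=
  (measurable_volterraKernel C β).ennreal_ofReal.lintegral_prod_right'

set_option maxHeartbeats 1000000 in
theorem lintegral_volterraLIntegral_mul (C : ℝ) {α β x : ℝ} (hα : 0 < α) (hβ : 0 < β)
    (hx : 0 < x) :
    ∫⁻ y in Ioo 0 x, volterraLIntegral C α (x - y) * volterraLIntegral C β y =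
      ENNReal.ofReal (Real.Gamma α * Real.Gamma β / Real.Gamma (α + β)) *
        volterraLIntegral C (α + β) x := by
  have hKm := fun γ => (measurable_volterraKernel C γ).ennreal_ofReal
  have hΓ : ∀ {t : ℝ}, 0 < t → 0 < Real.Gamma t := Real.Gamma_pos_of_pos
  have hprod : ∀ y, volterraLIntegral C α (x - y) * volterraLIntegral C β y =
      ∫⁻ s in Ioi (0 : ℝ), ∫⁻ r in Ioi (0 : ℝ),
        ENNReal.ofReal (volterraKernel C α (x - y) s) *
          ENNReal.ofReal (volterraKernel C β y r) := by
    intro y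
    have h1 := (hKm α).comp (measurable_prodMk_left (x := x - y))
    have h2 := (hKm β).comp (measurable_prodMk_left (x := y))
    simp only [Function.comp_def] at h1 h2
    simp_rw [lintegral_const_mul _ h2]
    rw [lintegral_mul_const _ h1]
    rfl
  simp_rw [hprod]
  have hG3 : Measurable fun q : (ℝ × ℝ) × ℝ =>
      ENNReal.ofReal (volterraKernel C α (x - q.1.1) q.1.2) *
          ENNReal.ofReal (volterraKernel C β q.1.1 q.2) :=
    ((hKm α).comp (by fun_prop : Measurable fun q : (ℝ × ℝ) × ℝ => (x - q.1.1, q.1.2))).mul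
      ((hKm β).comp (by fun_prop : Measurable fun q : (ℝ × ℝ) × ℝ => (q.1.1, q.2)))
  rw [lintegral_lintegral_swap]
  swap
  · exact hG3.lintegral_prod_right'.aemeasurable
  have hinner : ∀ s ∈ Ioi (0 : ℝ), ∫⁻ y in Ioo 0 x, ∫⁻ r in Ioi (0 : ℝ),
        ENNReal.ofReal (volterraKernel C α (x - y) s) *
          ENNReal.ofReal (volterraKernel C β y r) =
      ∫⁻ r in Ioi (0 : ℝ), ENNReal.ofReal (1 / Real.Gamma (s + r) * Real.exp (-C * (s + r)) *
        x ^ (s + r - 1) * (s ^ (α - 1) * r ^ (β - 1))) := by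
    intro s hs
    rw [lintegral_lintegral_swap]
    swap
    · exact (hG3.comp (by fun_prop : Measurable fun q : ℝ × ℝ => ((q.1, s), q.2))).aemeasurable
    refine setLIntegral_congr_fun measurableSet_Ioi fun r hr => ?_
    simp only [mem_Ioi] at hs hr
    have h := hΓ hs
    have h' := hΓ hr
    have h'' := hΓ (add_pos hs hr)
    have e : ∀ y ∈ Ioo 0 x, ENNReal.ofReal (volterraKernel C α (x - y) s) *
          ENNReal.ofReal (volterraKernel C β y r) =
        ENNReal.ofReal (1 / Real.Gamma s * (1 / Real.Gamma r) * Real.exp (-C * (s + r)) *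
          (s ^ (α - 1) * r ^ (β - 1))) *
          ENNReal.ofReal ((x - y) ^ (s - 1) * y ^ (r - 1)) := by
      intro y hy
      rw [← ENNReal.ofReal_mul (volterraKernel_nonneg _ _ (by linarith [hy.2]) hs),
        ← ENNReal.ofReal_mul (by positivity), volterraKernel, volterraKernel,
        mul_add, Real.exp_add]
      ring_nf
    rw [setLIntegral_congr_fun measurableSet_Ioo e, lintegral_const_mul _ (by fun_prop),
      setLIntegral_beta_kernel hs hr hx, ← ENNReal.ofReal_mul (by positivity)]
    congr 1
    field_simp
  rw [setLIntegral_congr_fun measurableSet_Ioi hinner, lintegral_Ioi_Ioi_eq_lintegral_Ioo]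
  swap
  · have := measurable_Gamma_inv.comp (measurable_fst.add measurable_snd : Measurable
      fun p : ℝ × ℝ => p.1 + p.2)
    refine Measurable.ennreal_ofReal (((Measurable.mul this ?_).mul ?_).mul ?_) <;> fun_prop
  rw [volterraLIntegral, ← lintegral_const_mul]
  swap
  · exact (hKm (α + β)).comp (measurable_prodMk_left (x := x))
  refine setLIntegral_congr_fun measurableSet_Ioi fun u hu => ?_
  simp only [mem_Ioi] at hu
  have h := hΓ hu
  have e : ∀ r ∈ Ioo 0 u, ENNReal.ofReal (1 / Real.Gamma (u - r + r) *
        Real.exp (-C * (u - r + r)) * x ^ (u - r + r - 1) * ((u - r) ^ (α - 1) * r ^ (β - 1))) =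
      ENNReal.ofReal (1 / Real.Gamma u * Real.exp (-C * u) * x ^ (u - 1)) *
        ENNReal.ofReal ((u - r) ^ (α - 1) * r ^ (β - 1)) := by
    intro r _
    rw [sub_add_cancel, ← ENNReal.ofReal_mul (by positivity)]
  have hA := hΓ hα
  have hB := hΓ hβ
  have hAB := hΓ (add_pos hα hβ)
  rw [setLIntegral_congr_fun measurableSet_Ioo e, lintegral_const_mul _ (by fun_prop),
    setLIntegral_beta_kernel hα hβ hu, ← ENNReal.ofReal_mul (by positivity),
    ← ENNReal.ofReal_mul (by positivity), volterraKernel]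
  ring_nf

theorem rpow_mul_exp_neg_le_Gamma_add_one {R s : ℝ} (hR : 0 < R) (hs : 0 < s) :
    R ^ s * Real.exp (-R) ≤ Real.Gamma (s + 1) := by
  rw [Real.Gamma_eq_integral (by linarith), ← integral_exp_neg_Ioi, ← integral_const_mul]
  have hint := Real.GammaIntegral_convergent (show 0 < s + 1 by linarith)
  calc ∫ t in Ioi R, R ^ s * Real.exp (-t)
      ≤ ∫ t in Ioi R, Real.exp (-t) * t ^ (s + 1 - 1) := by
        refine setIntegral_mono_on ((integrableOn_exp_neg_Ioi R).const_mul _)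
          (hint.mono_set (Ioi_subset_Ioi hR.le)) measurableSet_Ioi fun t ht => ?_
        rw [mul_comm, add_sub_cancel_right]
        have := Real.rpow_le_rpow hR.le (le_of_lt ht) hs.le
        gcongr
    _ ≤ _ := by
        refine setIntegral_mono_set hint ?_ (Ioi_subset_Ioi hR.le).eventuallyLE
        filter_upwards [ae_restrict_mem measurableSet_Ioi] with t ht
        have : (0 : ℝ) < t := ht
        simp only [Pi.zero_apply]
        positivity

theorem lintegral_rpow_div_Gamma_lt_top {K γ : ℝ} (hK : 0 < K) (hγ : 0 < γ) :
    ∫⁻ s in Ioi (0 : ℝ), ENNReal.ofReal (K ^ s * s ^ (γ - 1) / Real.Gamma (s + 1)) < ∞ := by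
  have hR : 0 < K * Real.exp 1 := by positivity
  have hint := (Real.GammaIntegral_convergent hγ).const_mul (Real.exp (K * Real.exp 1))
  refine lt_of_le_of_lt (setLIntegral_mono' measurableSet_Ioi fun s hs => ?_)
    hint.lintegral_lt_top
  simp only [mem_Ioi] at hs
  refine ENNReal.ofReal_le_ofReal ?_
  have h := rpow_mul_exp_neg_le_Gamma_add_one hR hs
  rw [Real.mul_rpow hK.le (Real.exp_pos _).le, ← Real.exp_mul, one_mul] at h
  rw [div_le_iff₀ (Real.Gamma_pos_of_pos (by linarith))]
  calc K ^ s * s ^ (γ - 1)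
      = Real.exp (K * Real.exp 1) * (Real.exp (-s) * s ^ (γ - 1)) *
        (K ^ s * Real.exp s * Real.exp (-(K * Real.exp 1))) := by
        have h1 : Real.exp (-s) * Real.exp s = 1 := by rw [← Real.exp_add]; simp
        have h2 : Real.exp (K * Real.exp 1) * Real.exp (-(K * Real.exp 1)) = 1 := by
          rw [← Real.exp_add]; simp
        linear_combination (-(K ^ s * s ^ (γ - 1))) * h2 - (K ^ s * s ^ (γ - 1)) *
          (Real.exp (K * Real.exp 1) * Real.exp (-(K * Real.exp 1))) * h1
    _ ≤ _ := by gcongr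

theorem volterraLIntegral_lt_top (C : ℝ) {β x : ℝ} (hβ : 0 < β) (hx : 0 < x) :
    volterraLIntegral C β x < ∞ := by
  have h := lintegral_rpow_div_Gamma_lt_top (K := x * Real.exp (-C)) (γ := β + 1)
    (by positivity) (by linarith)
  have h2 : volterraLIntegral C β x = ∫⁻ s in Ioi (0 : ℝ), ENNReal.ofReal (1 / x) *
      ENNReal.ofReal ((x * Real.exp (-C)) ^ s * s ^ (β + 1 - 1) / Real.Gamma (s + 1)) := by
    refine setLIntegral_congr_fun measurableSet_Ioi fun s hs => ?_
    simp only [mem_Ioi] at hs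
    have hg := Real.Gamma_pos_of_pos hs
    rw [← ENNReal.ofReal_mul (by positivity), volterraKernel, Real.Gamma_add_one hs.ne',
      Real.mul_rpow hx.le (Real.exp_pos _).le, ← Real.exp_mul, add_sub_cancel_right,
      Real.rpow_sub_one hs.ne', Real.rpow_sub_one hx.ne']
    congr 1
    field_simp
  rw [h2, lintegral_const_mul' _ _ ENNReal.ofReal_ne_top]
  exact ENNReal.mul_lt_top ENNReal.ofReal_lt_top h

theorem lintegral_volterraLIntegral_lt_top (C : ℝ) {β ω : ℝ} (hβ : 0 < β) (hω : 0 < ω) :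
    ∫⁻ x in Ioo 0 ω, volterraLIntegral C β x < ∞ := by
  have h := lintegral_rpow_div_Gamma_lt_top (K := ω * Real.exp (-C)) (γ := β)
    (by positivity) hβ
  convert h using 1
  unfold volterraLIntegral
  rw [lintegral_lintegral_swap (measurable_volterraKernel C β).ennreal_ofReal.aemeasurable]
  refine setLIntegral_congr_fun measurableSet_Ioi fun s hs => ?_
  simp only [mem_Ioi] at hs
  have hg := Real.Gamma_pos_of_pos hs
  have h1 := setLIntegral_beta_kernel (s := 1) one_pos hs hω
  have e : ∀ x ∈ Ioo 0 ω, ENNReal.ofReal (volterraKernel C β x s) =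
      ENNReal.ofReal ((1 / Real.Gamma s) * Real.exp (-C * s) * s ^ (β - 1)) *
        ENNReal.ofReal ((ω - x) ^ (1 - 1 : ℝ) * x ^ (s - 1)) := by
    intro x _
    rw [← ENNReal.ofReal_mul (by positivity), volterraKernel, sub_self, Real.rpow_zero, one_mul]
  rw [setLIntegral_congr_fun measurableSet_Ioo e, lintegral_const_mul _ (by fun_prop), h1,
    ← ENNReal.ofReal_mul (by positivity), Real.mul_rpow hω.le (Real.exp_pos _).le,
    ← Real.exp_mul, Real.Gamma_one, add_sub_cancel_left, add_comm 1 s]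
  congr 1
  field_simp

theorem convolution_mul_eq_setIntegral_Ioo {f g : ℝ → ℂ} (hf : ∀ x ≤ 0, f x = 0)
    (hg : ∀ x ≤ 0, g x = 0) (x : ℝ) :
    (f ⋆[ContinuousLinearMap.mul ℂ ℂ, volume] g) x = ∫ t in Ioo 0 x, f (x - t) * g t := by
  rw [convolution_mul_swap]
  refine (setIntegral_eq_integral_of_forall_compl_eq_zero fun t ht => ?_).symm
  rcases le_or_gt t 0 with h | h
  · rw [hg t h, mul_zero]
  · rw [hf (x - t) (by by_contra! h'; exact ht ⟨h, by linarith⟩), zero_mul]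

theorem ae_convolution_mul_assoc {f g k : ℝ → ℂ} (hf : Integrable f) (hg : Integrable g)
    (hk : Integrable k) :
    ∀ᵐ x : ℝ, ((f ⋆[ContinuousLinearMap.mul ℂ ℂ, volume] g)
        ⋆[ContinuousLinearMap.mul ℂ ℂ, volume] k) x =
      (f ⋆[ContinuousLinearMap.mul ℂ ℂ, volume]
        (g ⋆[ContinuousLinearMap.mul ℂ ℂ, volume] k)) x := by
  have h := hf.norm.ae_convolution_exists (ContinuousLinearMap.mul ℝ ℝ)
    (hg.norm.integrable_convolution (ContinuousLinearMap.mul ℝ ℝ) hk.norm)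
  filter_upwards [h] with x hx
  exact convolution_assoc _ _ _ _ (fun a b c => mul_assoc a b c) hf.aestronglyMeasurable
    hg.aestronglyMeasurable hk.aestronglyMeasurable (hf.ae_convolution_exists _ hg)
    (hg.norm.ae_convolution_exists _ hk.norm) hx

theorem setIntegral_volterraKernel (C β : ℝ) {x : ℝ} (hx : 0 < x) :
    ∫ s in Ioi (0 : ℝ), volterraKernel C β x s = (volterraLIntegral C β x).toReal := by
  refine integral_eq_lintegral_of_nonneg_ae ?_ ?_
  · filter_upwards [ae_restrict_mem measurableSet_Ioi] with s hs
    exact volterraKernel_nonneg C β hx.le hs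
  · exact ((measurable_volterraKernel C β).comp
      (measurable_prodMk_left (x := x))).aestronglyMeasurable

theorem setIntegral_volterraLIntegral_mul (C : ℝ) {α β x : ℝ} (hα : 0 < α) (hβ : 0 < β)
    (hx : 0 < x) :
    ∫ y in Ioo 0 x, (volterraLIntegral C α (x - y)).toReal * (volterraLIntegral C β y).toReal =
      Real.Gamma α * Real.Gamma β / Real.Gamma (α + β) *
        (volterraLIntegral C (α + β) x).toReal := by
  have hA := Real.Gamma_pos_of_pos hα
  have hB := Real.Gamma_pos_of_pos hβ
  have hAB := Real.Gamma_pos_of_pos (add_pos hα hβ)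
  simp_rw [← ENNReal.toReal_mul]
  rw [integral_toReal, lintegral_volterraLIntegral_mul C hα hβ hx, ENNReal.toReal_mul,
    ENNReal.toReal_ofReal (by positivity)]
  · exact (((measurable_volterraLIntegral C α).comp (measurable_id.const_sub x)).mul
      (measurable_volterraLIntegral C β)).aemeasurable
  · filter_upwards [ae_restrict_mem measurableSet_Ioo] with y hy
    exact ENNReal.mul_lt_top (volterraLIntegral_lt_top C hα (by linarith [hy.2]))
      (volterraLIntegral_lt_top C hβ hy.1)

theorem integrable_indicator_volterraLIntegral (C : ℝ) {β ω : ℝ} (hβ : 0 < β) (hω : 0 < ω) :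
    Integrable ((Ioo 0 ω).indicator fun x => ((volterraLIntegral C β x).toReal : ℂ)) := by
  rw [integrable_indicator_iff measurableSet_Ioo]
  exact (integrable_toReal_of_lintegral_ne_top (measurable_volterraLIntegral C β).aemeasurable
    (lintegral_volterraLIntegral_lt_top C hβ hω).ne).ofReal

theorem stmt_11 (C : ℝ) (E : ℝ → ℝ → ℝ)
    (hE : ∀ γ : ℝ, 0 < γ → ∀ x : ℝ, 0 < x →
      E γ x = ∫ s in Ioi (0 : ℝ),
        (1 / Real.Gamma s) * Real.exp (-C * s) * s ^ (γ - 1) * x ^ (s - 1)) :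
    (∀ α β : ℝ, 0 < α → 0 < β → ∀ x : ℝ, 0 < x →
      ∫ y in Ioo (0 : ℝ) x, E α (x - y) * E β y =
        (Real.Gamma α * Real.Gamma β / Real.Gamma (α + β)) * E (α + β) x) ∧
    (∀ ω : ℝ, 0 < ω → ∀ α β : ℝ, 0 < α → 0 < β →
      ∀ Vα Vβ Vαβ : Lp ℂ 2 (volume.restrict (Ioo 0 ω)) →L[ℂ] Lp ℂ 2 (volume.restrict (Ioo 0 ω)),
        (∀ f : Lp ℂ 2 (volume.restrict (Ioo 0 ω)),
          (⇑(Vα f) : ℝ → ℂ) =ᵐ[volume.restrict (Ioo 0 ω)]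
            fun x : ℝ => (1 / Real.Gamma α : ℝ) • ∫ t in Ioo (0 : ℝ) x, (E α (x - t) : ℂ) * f t) →
        (∀ f : Lp ℂ 2 (volume.restrict (Ioo 0 ω)),
          (⇑(Vβ f) : ℝ → ℂ) =ᵐ[volume.restrict (Ioo 0 ω)]
            fun x : ℝ => (1 / Real.Gamma β : ℝ) • ∫ t in Ioo (0 : ℝ) x, (E β (x - t) : ℂ) * f t) →
        (∀ f : Lp ℂ 2 (volume.restrict (Ioo 0 ω)),
          (⇑(Vαβ f) : ℝ → ℂ) =ᵐ[volume.restrict (Ioo 0 ω)]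
            fun x : ℝ => (1 / Real.Gamma (α + β) : ℝ) •
              ∫ t in Ioo (0 : ℝ) x, (E (α + β) (x - t) : ℂ) * f t) →
        Vα.comp Vβ = Vαβ) := by
  have hE' : ∀ γ : ℝ, 0 < γ → ∀ x : ℝ, 0 < x → E γ x = (volterraLIntegral C γ x).toReal :=
    fun γ hγ x hx => (hE γ hγ x hx).trans (setIntegral_volterraKernel C γ hx)
  have hconv : ∀ α β : ℝ, 0 < α → 0 < β → ∀ x : ℝ, 0 < x →
      ∫ y in Ioo (0 : ℝ) x, E α (x - y) * E β y =
        (Real.Gamma α * Real.Gamma β / Real.Gamma (α + β)) * E (α + β) x := by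
    intro α β hα hβ x hx
    rw [hE' _ (add_pos hα hβ) x hx, ← setIntegral_volterraLIntegral_mul C hα hβ hx]
    refine setIntegral_congr_fun measurableSet_Ioo fun y hy => ?_
    rw [hE' α hα _ (by linarith [hy.2]), hE' β hβ y hy.1]
  refine ⟨hconv, fun ω hω α β hα hβ Vα Vβ Vαβ hVα hVβ hVαβ => ?_⟩
  refine ContinuousLinearMap.ext fun f => Lp.ext ?_
  have hA := Real.Gamma_pos_of_pos hα
  have hB := Real.Gamma_pos_of_pos hβ
  have hAB := Real.Gamma_pos_of_pos (add_pos hα hβ)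
  set a : ℝ → ℝ → ℂ := fun γ =>
    (Ioo 0 ω).indicator fun x => ((volterraLIntegral C γ x).toReal : ℂ)
  have ha_int : ∀ γ, 0 < γ → Integrable (a γ) :=
    fun γ hγ => integrable_indicator_volterraLIntegral C hγ hω
  have ha_zero : ∀ γ, ∀ x ≤ 0, a γ x = 0 :=
    fun γ x hx => indicator_of_notMem (fun h => hx.not_gt h.1) _
  have ha_eq : ∀ γ, 0 < γ → ∀ x ∈ Ioo 0 ω, a γ x = E γ x := by
    intro γ hγ x hx
    rw [hE' γ hγ x hx.1]
    exact indicator_of_mem hx _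
  set F : ℝ → ℂ := (Ioo 0 ω).indicator f
  have hF_int : Integrable F :=
    (integrable_indicator_iff measurableSet_Ioo).2 ((Lp.memLp f).integrable one_le_two)
  have hF_zero : ∀ x ≤ 0, F x = 0 :=
    fun x hx => indicator_of_notMem (fun h => hx.not_gt h.1) _
  have hF_ae : ⇑f =ᵐ[volume.restrict (Ioo 0 ω)] F :=
    (indicator_ae_eq_restrict measurableSet_Ioo).symm
  have hconv_zero : ∀ γ, ∀ x ≤ 0,
      (a γ ⋆[ContinuousLinearMap.mul ℂ ℂ, volume] F) x = 0 := by
    intro γ x hx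
    rw [convolution_mul_eq_setIntegral_Ioo (ha_zero γ) hF_zero, Ioo_eq_empty hx.not_gt,
      setIntegral_empty]
  have key : ∀ γ, 0 < γ → ∀ g h : ℝ → ℂ, (∀ x ≤ 0, h x = 0) →
      g =ᵐ[volume.restrict (Ioo 0 ω)] h → ∀ x ∈ Ioo 0 ω,
      ∫ t in Ioo (0 : ℝ) x, (E γ (x - t) : ℂ) * g t =
        (a γ ⋆[ContinuousLinearMap.mul ℂ ℂ, volume] h) x := by
    intro γ hγ g h hh hgh x hx
    rw [convolution_mul_eq_setIntegral_Ioo (ha_zero γ) hh]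
    refine integral_congr_ae ?_
    filter_upwards [ae_restrict_of_ae_restrict_of_subset (Ioo_subset_Ioo_right hx.2.le) hgh,
      ae_restrict_mem measurableSet_Ioo] with t ht htx
    rw [ht, ha_eq γ hγ (x - t) ⟨by linarith [htx.2], by linarith [htx.1, hx.2]⟩]
  have hVβ' : ⇑(Vβ f) =ᵐ[volume.restrict (Ioo 0 ω)]
      (((1 / Real.Gamma β : ℝ) : ℂ) • (a β ⋆[ContinuousLinearMap.mul ℂ ℂ, volume] F)) := by
    filter_upwards [hVβ f, ae_restrict_mem measurableSet_Ioo] with x hx hxω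
    rw [hx, key β hβ f F hF_zero hF_ae x hxω, Pi.smul_apply, Complex.real_smul, smul_eq_mul]
  have hassoc := ae_restrict_of_ae (s := Ioo 0 ω)
    (ae_convolution_mul_assoc (ha_int α hα) (ha_int β hβ) hF_int)
  filter_upwards [hVα (Vβ f), hVαβ f, hassoc, ae_restrict_mem measurableSet_Ioo]
    with x h1 h2 h3 hx
  have haa : ∀ z ∈ Ioo 0 ω, (a α ⋆[ContinuousLinearMap.mul ℂ ℂ, volume] a β) z =
      ((Real.Gamma α * Real.Gamma β / Real.Gamma (α + β) : ℝ) : ℂ) * a (α + β) z := by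
    intro z hz
    rw [← key α hα (fun y => (E β y : ℂ)) (a β) (ha_zero β) ?_ z hz,
      ha_eq _ (add_pos hα hβ) z hz, ← Complex.ofReal_mul, ← hconv α β hα hβ z hz.1,
      ← integral_complex_ofReal]
    · simp
    · filter_upwards [ae_restrict_mem measurableSet_Ioo] with y hy
      exact (ha_eq β hβ y hy).symm
  have haa_zero : ∀ z ≤ 0, (a α ⋆[ContinuousLinearMap.mul ℂ ℂ, volume] a β) z = 0 := by
    intro z hz
    rw [convolution_mul_eq_setIntegral_Ioo (ha_zero α) (ha_zero β), Ioo_eq_empty hz.not_gt,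
      setIntegral_empty]
  have h4 : ((a α ⋆[ContinuousLinearMap.mul ℂ ℂ, volume] a β)
      ⋆[ContinuousLinearMap.mul ℂ ℂ, volume] F) x =
      ((Real.Gamma α * Real.Gamma β / Real.Gamma (α + β) : ℝ) : ℂ) *
        (a (α + β) ⋆[ContinuousLinearMap.mul ℂ ℂ, volume] F) x := by
    rw [convolution_mul_eq_setIntegral_Ioo haa_zero hF_zero,
      convolution_mul_eq_setIntegral_Ioo (ha_zero _) hF_zero, ← integral_const_mul]
    refine setIntegral_congr_fun measurableSet_Ioo fun t ht => ?_
    rw [haa (x - t) ⟨by linarith [ht.2], by linarith [ht.1, hx.2]⟩, mul_assoc]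
  rw [ContinuousLinearMap.comp_apply, h1, h2, key α hα _ _ ?_ hVβ' x hx,
    key _ (add_pos hα hβ) f F hF_zero hF_ae x hx, convolution_smul, Pi.smul_apply, ← h3, h4]
  · simp only [Complex.real_smul, smul_eq_mul]
    rw [← mul_assoc, ← mul_assoc, ← Complex.ofReal_mul, ← Complex.ofReal_mul]
    congr 2
    field_simp
  · intro y hy
    rw [Pi.smul_apply, hconv_zero β y hy, smul_zero]
end

section
/- Fix ω > 0, β > 0, and a real constant C. Define E_γ(x) = ∫₀^∞ (1/Γ(s)) e^{−Cs} s^{γ−1} x^{s−1} ds and m(γ) = (1/Γ(γ)) ∫₀^ω E_γ(x) dx for γ > 0. Then there exist M > 0 and n₀ ∈ ℕ such that for all n ≥ n₀: m(nβ) ≤ (M/ln(nβ))^{nβ}. -/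
open MeasureTheory Set

/-- The tail of the Euler integral bounds the Gamma function from below. -/
theorem rpow_sub_one_mul_exp_neg_le_Gamma {a y : ℝ} (ha : 1 ≤ a) (hy : 0 < y) :
    y ^ (a - 1) * Real.exp (-y) ≤ Real.Gamma a := by
  have hint := Real.GammaIntegral_convergent (s := a) (by linarith)
  have hsub : Ioi y ⊆ Ioi (0 : ℝ) := Ioi_subset_Ioi hy.le
  rw [Real.Gamma_eq_integral (by linarith)]
  calc y ^ (a - 1) * Real.exp (-y) = ∫ x in Ioi y, Real.exp (-x) * y ^ (a - 1) := by
        rw [integral_mul_const, integral_exp_neg_Ioi, mul_comm]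
    _ ≤ ∫ x in Ioi y, Real.exp (-x) * x ^ (a - 1) := by
        refine setIntegral_mono_on ((integrableOn_exp_neg_Ioi y).mul_const _)
          (hint.mono_set hsub) measurableSet_Ioi fun x hx => ?_
        gcongr
        exact (mem_Ioi.1 hx).le
    _ ≤ ∫ x in Ioi (0 : ℝ), Real.exp (-x) * x ^ (a - 1) := by
        refine setIntegral_mono_set hint ?_ hsub.eventuallyLE
        filter_upwards [ae_restrict_mem measurableSet_Ioi] with x hx
        have : 0 < x := hx
        positivity

theorem ofReal_integral_le_lintegral_ofReal {α : Type*} [MeasurableSpace α] {μ : Measure α}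
    (f : α → ℝ) : ENNReal.ofReal (∫ x, f x ∂μ) ≤ ∫⁻ x, ENNReal.ofReal (f x) ∂μ := by
  by_cases hf : Integrable f μ
  · calc ENNReal.ofReal (∫ x, f x ∂μ) ≤ ENNReal.ofReal (∫ x, max (f x) 0 ∂μ) :=
          ENNReal.ofReal_le_ofReal
            (integral_mono hf hf.pos_part fun x => le_max_left _ _)
      _ = ∫⁻ x, ENNReal.ofReal (max (f x) 0) ∂μ :=
          ofReal_integral_eq_lintegral_ofReal hf.pos_part
            (Filter.Eventually.of_forall fun x => le_max_right _ _)
      _ = ∫⁻ x, ENNReal.ofReal (f x) ∂μ := by simp [ENNReal.ofReal_max]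
  · simp [integral_undef hf]

theorem lintegral_Ioo_rpow_sub_one {s ω : ℝ} (hs : 0 < s) (hω : 0 < ω) :
    ∫⁻ x in Ioo 0 ω, ENNReal.ofReal (x ^ (s - 1)) = ENNReal.ofReal (ω ^ s / s) := by
  have hint : IntegrableOn (fun x : ℝ => x ^ (s - 1)) (Ioc 0 ω) :=
    (intervalIntegrable_iff_integrableOn_Ioc_of_le hω.le).1
      (intervalIntegral.intervalIntegrable_rpow' (by linarith))
  rw [setLIntegral_congr Ioo_ae_eq_Ioc, ← ofReal_integral_eq_lintegral_ofReal hint,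
    ← intervalIntegral.integral_of_le hω.le, integral_rpow (Or.inl (by linarith))]
  · simp [Real.zero_rpow hs.ne']
  · filter_upwards [ae_restrict_mem measurableSet_Ioc] with x hx
    exact Real.rpow_nonneg hx.1.le _

theorem lintegral_Ioi_exp_neg :
    ∫⁻ s in Ioi (0 : ℝ), ENNReal.ofReal (Real.exp (-s)) = 1 := by
  rw [← ofReal_integral_eq_lintegral_ofReal (integrableOn_exp_neg_Ioi 0)
    (Filter.Eventually.of_forall fun s => (Real.exp_pos _).le), integral_exp_neg_Ioi]
  simp

theorem lintegral_lintegral_exp_neg_mul_rpow {ω : ℝ} (hω : 0 < ω) :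
    ∫⁻ x in Ioo 0 ω, ∫⁻ s in Ioi (0 : ℝ),
      ENNReal.ofReal (s * Real.exp (-s) * ω ^ (-s) * x ^ (s - 1)) = 1 := by
  rw [lintegral_lintegral_swap, ← lintegral_Ioi_exp_neg]
  · refine setLIntegral_congr_fun measurableSet_Ioi fun s hs => ?_
    have hs : 0 < s := hs
    have hc : 0 ≤ s * Real.exp (-s) * ω ^ (-s) := by positivity
    simp only [ENNReal.ofReal_mul hc]
    rw [lintegral_const_mul' _ _ ENNReal.ofReal_ne_top, lintegral_Ioo_rpow_sub_one hs hω,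
      ← ENNReal.ofReal_mul hc, Real.rpow_neg hω.le]
    congr 1
    have : 0 < ω ^ s := by positivity
    field_simp
  · apply Measurable.aemeasurable
    unfold Function.uncurry
    fun_prop

theorem integrand_le {γ t s x ω C : ℝ} (hγ : 1 ≤ γ) (ht : 0 < t) (hs : 0 < s) (hx : 0 < x)
    (hω : 0 < ω) :
    (1 / Real.Gamma s) * Real.exp (-C * s) * s ^ (γ - 1) * x ^ (s - 1) ≤
      Real.Gamma γ * (t ^ (γ - 1))⁻¹ * Real.exp (Real.exp (1 - C + t) * ω) *
        (s * Real.exp (-s) * ω ^ (-s) * x ^ (s - 1)) := by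
  set y := Real.exp (1 - C + t) * ω with hy
  have hy0 : 0 < y := by positivity
  have hΓs := Real.Gamma_pos_of_pos hs
  have hΓγ := Real.Gamma_pos_of_pos (show 0 < γ by linarith)
  have h1 : s ^ (γ - 1) ≤ Real.Gamma γ * (t ^ (γ - 1))⁻¹ * Real.exp (t * s) := by
    have h := rpow_sub_one_mul_exp_neg_le_Gamma hγ (mul_pos ht hs)
    rw [Real.mul_rpow ht.le hs.le, Real.exp_neg] at h
    have : 0 < t ^ (γ - 1) := by positivity
    field_simp at h ⊢
    linarith
  have h2 : 1 / Real.Gamma s ≤ s * Real.exp y * y ^ (-s) := by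
    have h := rpow_sub_one_mul_exp_neg_le_Gamma (show 1 ≤ s + 1 by linarith) hy0
    rw [Real.Gamma_add_one hs.ne', add_sub_cancel_right, Real.exp_neg] at h
    rw [Real.rpow_neg hy0.le]
    have : 0 < y ^ s := by positivity
    field_simp at h ⊢
    linarith
  have h3 : y ^ (-s) * Real.exp (-C * s) * Real.exp (t * s) = Real.exp (-s) * ω ^ (-s) := by
    rw [hy, Real.mul_rpow (Real.exp_pos _).le hω.le, ← Real.exp_mul]
    rw [mul_right_comm _ (ω ^ (-s)), mul_right_comm _ (ω ^ (-s)), ← Real.exp_add,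
      ← Real.exp_add]
    congr 2
    ring
  calc _ ≤ (s * Real.exp y * y ^ (-s)) * Real.exp (-C * s) *
        (Real.Gamma γ * (t ^ (γ - 1))⁻¹ * Real.exp (t * s)) * x ^ (s - 1) := by gcongr
    _ = Real.Gamma γ * (t ^ (γ - 1))⁻¹ * Real.exp y * s *
        (y ^ (-s) * Real.exp (-C * s) * Real.exp (t * s)) * x ^ (s - 1) := by ring
    _ = _ := by rw [h3]; ring

theorem integral_integral_le {γ t ω : ℝ} (C : ℝ) (hγ : 1 ≤ γ) (ht : 0 < t) (hω : 0 < ω) :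
    ∫ x in Ioo 0 ω, ∫ s in Ioi (0 : ℝ),
        (1 / Real.Gamma s) * Real.exp (-C * s) * s ^ (γ - 1) * x ^ (s - 1) ≤
      Real.Gamma γ * (t ^ (γ - 1))⁻¹ * Real.exp (Real.exp (1 - C + t) * ω) := by
  set K := Real.Gamma γ * (t ^ (γ - 1))⁻¹ * Real.exp (Real.exp (1 - C + t) * ω) with hK
  have hK0 : 0 ≤ K := by
    have := Real.Gamma_pos_of_pos (show 0 < γ by linarith)
    positivity
  rw [← ENNReal.ofReal_le_ofReal_iff hK0]
  calc _ ≤ ∫⁻ x in Ioo 0 ω, ∫⁻ s in Ioi (0 : ℝ), ENNReal.ofReal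
        ((1 / Real.Gamma s) * Real.exp (-C * s) * s ^ (γ - 1) * x ^ (s - 1)) :=
        (ofReal_integral_le_lintegral_ofReal _).trans
          (lintegral_mono fun x => ofReal_integral_le_lintegral_ofReal _)
    _ ≤ ∫⁻ x in Ioo 0 ω, ∫⁻ s in Ioi (0 : ℝ),
        ENNReal.ofReal K *
          ENNReal.ofReal (s * Real.exp (-s) * ω ^ (-s) * x ^ (s - 1)) := by
        refine setLIntegral_mono' measurableSet_Ioo fun x hx =>
          setLIntegral_mono' measurableSet_Ioi fun s hs => ?_
        rw [← ENNReal.ofReal_mul hK0]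
        exact ENNReal.ofReal_le_ofReal (integrand_le hγ ht hs hx.1 hω)
    _ = ENNReal.ofReal K := by
        simp only [lintegral_const_mul' _ _ ENNReal.ofReal_ne_top]
        rw [lintegral_lintegral_exp_neg_mul_rpow hω, mul_one]

theorem stmt_12 (ω : ℝ) (hω : 0 < ω) (β : ℝ) (hβ : 0 < β) (C : ℝ)
    (E : ℝ → ℝ → ℝ)
    (hE : ∀ γ : ℝ, 0 < γ → ∀ x : ℝ, 0 < x →
      E γ x = ∫ s in Ioi (0 : ℝ),
        (1 / Real.Gamma s) * Real.exp (-C * s) * s ^ (γ - 1) * x ^ (s - 1))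
    (m : ℝ → ℝ)
    (hm : ∀ γ : ℝ, 0 < γ → m γ = (1 / Real.Gamma γ) * ∫ x in Ioo (0 : ℝ) ω, E γ x) :
    ∃ M > (0 : ℝ), ∃ n₀ : ℕ, ∀ n : ℕ, n₀ ≤ n →
      m ((n : ℝ) * β) ≤ (M / Real.log ((n : ℝ) * β)) ^ ((n : ℝ) * β) := by
  obtain ⟨n₀, hn₀⟩ := exists_nat_gt (1 / β)
  refine ⟨Real.exp (1 + Real.exp (1 - C) * ω), Real.exp_pos _, n₀, fun n hn => ?_⟩
  have hγ : 1 < (n : ℝ) * β := by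
    rw [← div_lt_iff₀ hβ]
    exact hn₀.trans_le (by exact_mod_cast hn)
  generalize (n : ℝ) * β = γ at hγ ⊢
  have hγ0 : 0 < γ := by linarith
  have ht : 0 < Real.log γ := Real.log_pos hγ
  have hΓ := Real.Gamma_pos_of_pos hγ0
  have hlog : Real.log γ ≤ Real.exp γ := by
    linarith [Real.log_le_sub_one_of_pos hγ0, Real.add_one_le_exp γ]
  rw [hm γ hγ0, setIntegral_congr_fun measurableSet_Ioo fun x hx => hE γ hγ0 x hx.1]
  calc _ ≤ (1 / Real.Gamma γ) * (Real.Gamma γ * (Real.log γ ^ (γ - 1))⁻¹ *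
        Real.exp (Real.exp (1 - C + Real.log γ) * ω)) := by
        gcongr
        exact integral_integral_le C hγ.le ht hω
    _ = Real.log γ * Real.exp (Real.exp (1 - C) * ω * γ) / Real.log γ ^ γ := by
        rw [Real.rpow_sub_one ht.ne', Real.exp_add, Real.exp_log hγ0]
        field_simp
    _ ≤ Real.exp γ * Real.exp (Real.exp (1 - C) * ω * γ) / Real.log γ ^ γ := by gcongr
    _ = _ := by
        rw [Real.div_rpow (Real.exp_pos _).le ht.le, ← Real.exp_mul, ← Real.exp_add]
        ring_nf
end

section
/- Fix ω > 0, β > 0, and a real constant C, and let φ : (0,ω) → ℝ be a bounded measurable function. Let S be the multiplication operator (Sf)(x) = φ(x)f(x) on L²(0,ω) and V_β the operator (V_β f)(x) = (1/Γ(β)) ∫₀ˣ E_β(x−t) f(t) dt, where E_β(x) = ∫₀^∞ (1/Γ(s)) e^{−Cs} s^{β−1} x^{s−1} ds. For λ with Im λ ≠ 0 set c_n(λ) = (−(Im λ)·(S − λI)⁻¹V_β)ⁿ, r_n(y) = sup_{x ∈ ℝ} ‖c_n(x + iy)‖^{1/n}, and let N(y) be the number of indices n ≥ 1 with r_n(y)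 > |y|/2. Then there exist constants C₁ > 0 and δ > 0 such that for all y with 0 < |y| ≤ δ and N(y) ≥ 1: ln N(y) ≤ C₁·(1/|y|)^{1/β}. -/
open MeasureTheory Set

/-- Young's inequality for the convolution of an `L¹` and an `L²` function. -/
theorem lintegral_sq_convolution_le {k g : ℝ → ENNReal} (hk : Measurable k) (hg : AEMeasurable g) :
    ∫⁻ x, (∫⁻ t, k (x - t) * g t) ^ 2 ≤ (∫⁻ u, k u) ^ 2 * ∫⁻ t, g t ^ 2 := by
  have hpt : ∀ x, (∫⁻ t, k (x - t) * g t) ^ 2 ≤ (∫⁻ u, k u) * ∫⁻ t, k (x - t) * g t ^ 2 := by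
    intro x
    have hkx : Measurable fun t => k (x - t) := by fun_prop
    have h := ENNReal.lintegral_mul_norm_pow_le (μ := volume) (f := fun t => k (x - t))
      (g := fun t => k (x - t) * g t ^ 2) hkx.aemeasurable
      (hkx.aemeasurable.mul (hg.pow_const 2)) (p := 1 / 2) (q := 1 / 2)
      (by norm_num) (by norm_num) (by norm_num)
    have hsqrt : ∀ a : ENNReal, (a ^ 2) ^ (1 / 2 : ℝ) = a := fun a => by
      rw [← ENNReal.rpow_natCast, ← ENNReal.rpow_mul]; norm_num
    have hsq : ∀ a : ENNReal, (a ^ (1 / 2 : ℝ)) ^ 2 = a := fun a => by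
      rw [← ENNReal.rpow_natCast, ← ENNReal.rpow_mul]; norm_num
    have hmul : ∀ a b : ENNReal, a ^ (1 / 2 : ℝ) * (a * b ^ 2) ^ (1 / 2 : ℝ) = a * b := by
      intro a b
      rw [← ENNReal.mul_rpow_of_nonneg _ _ (by norm_num), ← hsqrt (a * b)]
      congr 1
      ring
    simp only [hmul] at h
    calc _ ≤ _ := pow_le_pow_left' h 2
      _ = _ := by rw [mul_pow, hsq, hsq, lintegral_sub_left_eq_self k x]
  have hmeas : AEMeasurable (Function.uncurry fun x t => k (x - t) * g t ^ 2)
      ((volume : Measure ℝ).prod volume) :=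
    (hk.comp (measurable_fst.sub measurable_snd)).aemeasurable.mul
      ((hg.pow_const 2).comp_snd)
  calc ∫⁻ x, (∫⁻ t, k (x - t) * g t) ^ 2
      ≤ ∫⁻ x, (∫⁻ u, k u) * ∫⁻ t, k (x - t) * g t ^ 2 := lintegral_mono hpt
    _ = (∫⁻ u, k u) * ∫⁻ x, ∫⁻ t, k (x - t) * g t ^ 2 :=
        lintegral_const_mul'' _ hmeas.lintegral_prod_right'
    _ = (∫⁻ u, k u) * ∫⁻ t, ∫⁻ x, k (x - t) * g t ^ 2 := by rw [lintegral_lintegral_swap hmeas]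
    _ = (∫⁻ u, k u) * ∫⁻ t, (∫⁻ u, k u) * g t ^ 2 := by
        congr 1
        refine lintegral_congr fun t => ?_
        rw [lintegral_mul_const _ (by fun_prop), lintegral_sub_right_eq_self k t]
    _ = _ := by rw [lintegral_const_mul'' _ (hg.pow_const 2), ← mul_assoc, sq]

theorem Real.measurable_Gamma : Measurable Real.Gamma := by
  have h : Measurable fun s : ℂ => (Complex.Gamma s)⁻¹ :=
    Complex.differentiable_one_div_Gamma.continuous.measurable
  have h' : Measurable fun s : ℝ => ((Complex.Gamma s)⁻¹⁻¹).re :=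
    Complex.measurable_re.comp (h.inv.comp Complex.measurable_ofReal)
  simpa [Complex.Gamma_ofReal] using h'

theorem lintegral_rpow_mul_exp_neg_mul_Ioi {a r : ℝ} (ha : 0 < a) (hr : 0 < r) :
    ∫⁻ t in Ioi (0 : ℝ), ENNReal.ofReal (t ^ (a - 1) * Real.exp (-(r * t))) =
      ENNReal.ofReal ((1 / r) ^ a * Real.Gamma a) := by
  have h := Real.integral_rpow_mul_exp_neg_mul_Ioi ha hr
  have hpos : 0 < (1 / r) ^ a * Real.Gamma a :=
    mul_pos (Real.rpow_pos_of_pos (by positivity) _) (Real.Gamma_pos_of_pos ha)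
  have hint : IntegrableOn (fun t : ℝ => t ^ (a - 1) * Real.exp (-(r * t))) (Ioi 0) := by
    by_contra hn
    exact hpos.ne' (h ▸ integral_undef hn)
  rw [← h, ofReal_integral_eq_lintegral_ofReal hint]
  filter_upwards [ae_restrict_mem measurableSet_Ioi] with t ht
  have := Real.rpow_nonneg (le_of_lt ht) (a - 1)
  positivity

/-- The integrand defining `E_β(u)`. -/
noncomputable def kernelIntegrand (β C u s : ℝ) : ℝ :=
  (1 / Real.Gamma s) * Real.exp (-C * s) * s ^ (β - 1) * u ^ (s - 1)

/-- The weighted kernel `E_β(u) exp(-pu) / Γ(β)` on the half-line, extended by zero. -/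
noncomputable def weightedKernel (β C p : ℝ) (u : ℝ) : ENNReal :=
  (Ioi (0 : ℝ)).indicator (fun u => ∫⁻ s in Ioi (0 : ℝ),
    ENNReal.ofReal (1 / Real.Gamma β * (kernelIntegrand β C u s * Real.exp (-(p * u))))) u

theorem measurable_kernelIntegrand (β C p : ℝ) :
    Measurable fun z : ℝ × ℝ => ENNReal.ofReal
      (1 / Real.Gamma β * (kernelIntegrand β C z.1 z.2 * Real.exp (-(p * z.1)))) := by
  have := Real.measurable_Gamma
  unfold kernelIntegrand
  fun_prop

theorem measurable_weightedKernel (β C p : ℝ) : Measurable (weightedKernel β C p) :=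
  (measurable_kernelIntegrand β C p).lintegral_prod_right'.indicator measurableSet_Ioi

theorem lintegral_weightedKernel {β C p : ℝ} (hβ : 0 < β) (hp : 0 < p) (h : 0 < C + Real.log p) :
    ∫⁻ u, weightedKernel β C p u = ENNReal.ofReal ((1 / (C + Real.log p)) ^ β) := by
  have hΓ := Real.Gamma_pos_of_pos hβ
  unfold weightedKernel
  rw [lintegral_indicator measurableSet_Ioi,
    lintegral_lintegral_swap (measurable_kernelIntegrand β C p).aemeasurable]
  have hs : ∀ s ∈ Ioi (0 : ℝ), ∫⁻ u in Ioi (0 : ℝ), ENNReal.ofReal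
      (1 / Real.Gamma β * (kernelIntegrand β C u s * Real.exp (-(p * u)))) =
      ENNReal.ofReal (1 / Real.Gamma β) *
        ENNReal.ofReal (s ^ (β - 1) * Real.exp (-((C + Real.log p) * s))) := by
    intro s hs
    have hs : 0 < s := hs
    have hΓs := Real.Gamma_pos_of_pos hs
    have hc : 0 ≤ 1 / Real.Gamma β *
        ((1 / Real.Gamma s) * Real.exp (-C * s) * s ^ (β - 1)) := by positivity
    calc _ = ∫⁻ u in Ioi (0 : ℝ), ENNReal.ofReal (1 / Real.Gamma β *
            ((1 / Real.Gamma s) * Real.exp (-C * s) * s ^ (β - 1))) *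
            ENNReal.ofReal (u ^ (s - 1) * Real.exp (-(p * u))) := by
          refine lintegral_congr fun u => ?_
          rw [← ENNReal.ofReal_mul hc, kernelIntegrand]
          congr 1
          ring
      _ = _ := by
          rw [lintegral_const_mul _ (by fun_prop), lintegral_rpow_mul_exp_neg_mul_Ioi hs hp,
            ← ENNReal.ofReal_mul hc, ← ENNReal.ofReal_mul (by positivity)]
          congr 1
          have he : Real.exp (-((C + Real.log p) * s)) = Real.exp (-C * s) * (1 / p) ^ s := by
            rw [Real.rpow_def_of_pos (by positivity), ← Real.exp_add, one_div, Real.log_inv]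
            congr 1
            ring
          rw [he]
          field_simp
  rw [setLIntegral_congr_fun measurableSet_Ioi hs, lintegral_const_mul _ (by fun_prop),
    lintegral_rpow_mul_exp_neg_mul_Ioi hβ h, ← ENNReal.ofReal_mul (by positivity)]
  congr 1
  field_simp

theorem weight_mul_enorm_volterra_le {β C p ω : ℝ} (hβ : 0 < β) {E : ℝ → ℝ}
    (hE : ∀ x : ℝ, 0 < x → E x = ∫ s in Ioi (0 : ℝ), kernelIntegrand β C x s)
    (f : ℝ → ℂ) {x : ℝ} (hx : x ∈ Ioo 0 ω) :
    ENNReal.ofReal (Real.exp (-(p * x))) *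
        ‖(1 / Real.Gamma β : ℝ) • ∫ t in Ioo (0 : ℝ) x, (E (x - t) : ℂ) * f t‖ₑ ≤
      ∫⁻ t, weightedKernel β C p (x - t) *
        (Ioo 0 ω).indicator (fun t => ENNReal.ofReal (Real.exp (-(p * t))) * ‖f t‖ₑ) t := by
  have hΓ := Real.Gamma_pos_of_pos hβ
  have hEk : ∀ u : ℝ, 0 < u → ENNReal.ofReal (1 / Real.Gamma β) *
      (ENNReal.ofReal (Real.exp (-(p * u))) * ‖E u‖ₑ) ≤ weightedKernel β C p u := by
    intro u hu
    rw [hE u hu, weightedKernel, indicator_of_mem (mem_Ioi.2 hu)]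
    calc _ ≤ ENNReal.ofReal (1 / Real.Gamma β) * (ENNReal.ofReal (Real.exp (-(p * u))) *
            ∫⁻ s in Ioi (0 : ℝ), ‖kernelIntegrand β C u s‖ₑ) := by
          gcongr
          exact enorm_integral_le_lintegral_enorm _
      _ = ∫⁻ s in Ioi (0 : ℝ), ENNReal.ofReal (1 / Real.Gamma β) *
            (ENNReal.ofReal (Real.exp (-(p * u))) * ‖kernelIntegrand β C u s‖ₑ) := by
          rw [lintegral_const_mul' _ _ ENNReal.ofReal_ne_top,
            lintegral_const_mul' _ _ ENNReal.ofReal_ne_top]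
      _ = _ := by
          refine setLIntegral_congr_fun measurableSet_Ioi fun s hs => ?_
          have hs : 0 < s := hs
          have hΓs := Real.Gamma_pos_of_pos hs
          have hk : 0 ≤ kernelIntegrand β C u s := by
            unfold kernelIntegrand
            positivity
          rw [Real.enorm_eq_ofReal hk, ← ENNReal.ofReal_mul (by positivity),
            ← ENNReal.ofReal_mul (by positivity), mul_comm (Real.exp _)]
  calc _ ≤ ENNReal.ofReal (Real.exp (-(p * x))) * (ENNReal.ofReal (1 / Real.Gamma β) *
          ∫⁻ t in Ioo (0 : ℝ) x, ‖(E (x - t) : ℂ) * f t‖ₑ) := by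
        rw [enorm_smul, Real.enorm_eq_ofReal (by positivity)]
        gcongr
        exact enorm_integral_le_lintegral_enorm _
    _ = ∫⁻ t in Ioo (0 : ℝ) x, ENNReal.ofReal (Real.exp (-(p * x))) *
          (ENNReal.ofReal (1 / Real.Gamma β) * ‖(E (x - t) : ℂ) * f t‖ₑ) := by
        rw [lintegral_const_mul' _ _ ENNReal.ofReal_ne_top,
            lintegral_const_mul' _ _ ENNReal.ofReal_ne_top]
    _ ≤ ∫⁻ t in Ioo (0 : ℝ) x, weightedKernel β C p (x - t) *
        (Ioo 0 ω).indicator (fun t => ENNReal.ofReal (Real.exp (-(p * t))) * ‖f t‖ₑ) t := by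
        refine setLIntegral_mono_ae' measurableSet_Ioo (ae_of_all _ fun t ht => ?_)
        rw [indicator_of_mem (show t ∈ Ioo 0 ω from ⟨ht.1, ht.2.trans hx.2⟩)]
        refine le_trans (le_of_eq ?_)
          (mul_le_mul_left (hEk (x - t) (sub_pos.2 ht.2)) _)
        have he : Real.exp (-(p * x)) = Real.exp (-(p * (x - t))) * Real.exp (-(p * t)) := by
          rw [← Real.exp_add]
          congr 1
          ring
        have hn : ‖(E (x - t) : ℂ)‖ₑ = ‖E (x - t)‖ₑ := by
          rw [← ofReal_norm, ← ofReal_norm, Complex.norm_real]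
        rw [enorm_mul, he, ENNReal.ofReal_mul (by positivity), hn]
        ring
    _ ≤ _ := setLIntegral_le_lintegral _ _

/-- The square of the weighted `L²` norm on `(0, ω)` with weight `exp(-px)`. -/
noncomputable def weightedSq (ω p : ℝ) (f : ℝ → ℂ) : ENNReal :=
  ∫⁻ x in Ioo 0 ω, (ENNReal.ofReal (Real.exp (-(p * x))) * ‖f x‖ₑ) ^ 2

theorem weightedSq_volterra_le {β C p ω : ℝ} (hβ : 0 < β) (hp : 0 < p) (h : 0 < C + Real.log p)
    {E : ℝ → ℝ} (hE : ∀ x : ℝ, 0 < x → E x = ∫ s in Ioi (0 : ℝ), kernelIntegrand β C x s)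
    {f : ℝ → ℂ} (hf : AEStronglyMeasurable f (volume.restrict (Ioo 0 ω))) :
    weightedSq ω p (fun x => (1 / Real.Gamma β : ℝ) • ∫ t in Ioo (0 : ℝ) x, (E (x - t) : ℂ) * f t) ≤
      ENNReal.ofReal ((1 / (C + Real.log p)) ^ β) ^ 2 * weightedSq ω p f := by
  have hg : AEMeasurable
      ((Ioo 0 ω).indicator fun t => ENNReal.ofReal (Real.exp (-(p * t))) * ‖f t‖ₑ) := by
    rw [aemeasurable_indicator_iff measurableSet_Ioo]
    exact AEMeasurable.mul (by fun_prop) hf.enorm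
  have hY := lintegral_sq_convolution_le (measurable_weightedKernel β C p) hg
  rw [lintegral_weightedKernel hβ hp h] at hY
  calc _ ≤ ∫⁻ x in Ioo 0 ω, (∫⁻ t, weightedKernel β C p (x - t) *
        (Ioo 0 ω).indicator (fun t => ENNReal.ofReal (Real.exp (-(p * t))) * ‖f t‖ₑ) t) ^ 2 :=
        setLIntegral_mono_ae' measurableSet_Ioo
          (ae_of_all _ fun x hx => pow_le_pow_left' (weight_mul_enorm_volterra_le hβ hE f hx) 2)
    _ ≤ _ := setLIntegral_le_lintegral _ _
    _ ≤ _ := hY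
    _ = _ := by
      congr 1
      rw [weightedSq, ← lintegral_indicator measurableSet_Ioo]
      refine lintegral_congr fun t => ?_
      by_cases ht : t ∈ Ioo 0 ω <;> simp [ht]

theorem weightedSq_mono_ae {ω p : ℝ} {f g : ℝ → ℂ}
    (h : ∀ᵐ x ∂(volume.restrict (Ioo 0 ω)), ‖f x‖ₑ ≤ ‖g x‖ₑ) :
    weightedSq ω p f ≤ weightedSq ω p g := by
  refine lintegral_mono_ae ?_
  filter_upwards [h] with x hx
  gcongr

theorem enorm_Lp_sq {ω : ℝ} (f : Lp ℂ 2 (volume.restrict (Ioo 0 ω))) :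
    ‖f‖ₑ ^ 2 = ∫⁻ x in Ioo 0 ω, ‖f x‖ₑ ^ 2 := by
  rw [Lp.enorm_def, eLpNorm_eq_lintegral_rpow_enorm_toReal (by norm_num) (by norm_num),
    ← ENNReal.rpow_natCast, ← ENNReal.rpow_mul]
  simp

theorem weightedSq_le_enorm_sq {ω p : ℝ} (hp : 0 < p)
    (f : Lp ℂ 2 (volume.restrict (Ioo 0 ω))) : weightedSq ω p f ≤ ‖f‖ₑ ^ 2 := by
  rw [enorm_Lp_sq]
  refine setLIntegral_mono_ae' measurableSet_Ioo (ae_of_all _ fun x hx => ?_)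
  refine pow_le_pow_left' (mul_le_of_le_one_left' ?_) 2
  rw [ENNReal.ofReal_le_one, Real.exp_le_one_iff]
  have := mul_pos hp hx.1
  linarith

theorem enorm_sq_le_weightedSq {ω p : ℝ} (hp : 0 < p)
    (f : Lp ℂ 2 (volume.restrict (Ioo 0 ω))) :
    ‖f‖ₑ ^ 2 ≤ ENNReal.ofReal (Real.exp (p * ω)) ^ 2 * weightedSq ω p f := by
  rw [enorm_Lp_sq, weightedSq, ← lintegral_const_mul' _ _ (by simp)]
  refine setLIntegral_mono_ae' measurableSet_Ioo (ae_of_all _ fun x hx => ?_)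
  rw [← mul_pow, ← mul_assoc, ← ENNReal.ofReal_mul (by positivity), ← Real.exp_add]
  refine pow_le_pow_left' (le_mul_of_one_le_left' ?_) 2
  rw [ENNReal.one_le_ofReal, Real.one_le_exp_iff]
  have := mul_lt_mul_of_pos_left hx.2 hp
  linarith

/-- An operator contracting the weighted norm by the factor `a` has powers of norm at most
`exp(pω) aⁿ`. -/
theorem norm_pow_le_of_weightedSq_le {ω p a : ℝ} (hp : 0 < p) (ha : 0 ≤ a)
    {T : Lp ℂ 2 (volume.restrict (Ioo 0 ω)) →L[ℂ] Lp ℂ 2 (volume.restrict (Ioo 0 ω))}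
    (hT : ∀ f, weightedSq ω p (T f) ≤ ENNReal.ofReal a ^ 2 * weightedSq ω p f) (n : ℕ) :
    ‖T ^ n‖ ≤ Real.exp (p * ω) * a ^ n := by
  have hTn : ∀ f, weightedSq ω p ((T ^ n) f) ≤ (ENNReal.ofReal a ^ n) ^ 2 * weightedSq ω p f := by
    induction n with
    | zero => simp
    | succ n ih =>
      intro f
      rw [pow_succ, mul_apply_eq_comp]
      calc _ ≤ _ := ih (T f)
        _ ≤ (ENNReal.ofReal a ^ n) ^ 2 * (ENNReal.ofReal a ^ 2 * weightedSq ω p f) := by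
          gcongr
          exact hT f
        _ = _ := by ring
  refine ContinuousLinearMap.opNorm_le_bound _ (by positivity) fun f => ?_
  have h : ‖(T ^ n) f‖ₑ ^ 2 ≤ ENNReal.ofReal (Real.exp (p * ω) * a ^ n * ‖f‖) ^ 2 := by
    calc _ ≤ _ := enorm_sq_le_weightedSq hp _
      _ ≤ ENNReal.ofReal (Real.exp (p * ω)) ^ 2 * ((ENNReal.ofReal a ^ n) ^ 2 * ‖f‖ₑ ^ 2) := by
        gcongr
        exact (hTn f).trans (by gcongr; exact weightedSq_le_enorm_sq hp f)
      _ = _ := by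
        rw [ENNReal.ofReal_mul (by positivity), ENNReal.ofReal_mul (by positivity),
          ENNReal.ofReal_pow ha, ofReal_norm]
        ring
  rw [← ofReal_norm, ← ENNReal.ofReal_pow (by positivity), ← ENNReal.ofReal_pow (by positivity),
    ENNReal.ofReal_le_ofReal_iff (by positivity)] at h
  exact (pow_le_pow_iff_left₀ (by positivity) (by positivity) two_ne_zero).1 h

/-- The scaled resolvent of a real multiplication operator does not increase moduli. -/
theorem enorm_smul_resolvent_le {ω : ℝ} {φ : ℝ → ℝ}
    {S : Lp ℂ 2 (volume.restrict (Ioo 0 ω)) →L[ℂ] Lp ℂ 2 (volume.restrict (Ioo 0 ω))}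
    (hS : ∀ f : Lp ℂ 2 (volume.restrict (Ioo 0 ω)),
      (⇑(S f) : ℝ → ℂ) =ᵐ[volume.restrict (Ioo 0 ω)] fun x : ℝ => (φ x : ℂ) * f x)
    (z : ℂ) (g : Lp ℂ 2 (volume.restrict (Ioo 0 ω))) :
    ∀ᵐ x ∂(volume.restrict (Ioo 0 ω)),
      ‖((z.im : ℂ) • Ring.inverse (S - algebraMap ℂ _ z) g : Lp ℂ 2 (volume.restrict (Ioo 0 ω))) x‖ₑ
        ≤ ‖g x‖ₑ := by
  by_cases hu : IsUnit (S - algebraMap ℂ _ z)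
  · set h := Ring.inverse (S - algebraMap ℂ _ z) g with hh
    have hg : S h - z • h = g := by
      have := congrArg (fun A => A g) (Ring.mul_inverse_cancel _ hu)
      rwa [mul_apply_eq_comp, ← hh, sub_apply, Algebra.algebraMap_eq_smul_one] at this
    filter_upwards [hS h, Lp.coeFn_sub (S h) (z • h), Lp.coeFn_smul z h,
      Lp.coeFn_smul (z.im : ℂ) h] with x h1 h2 h3 h4
    rw [hg] at h2
    rw [h4, h2, Pi.sub_apply, h1, h3, Pi.smul_apply, Pi.smul_apply, smul_eq_mul, smul_eq_mul,
      ← sub_mul, enorm_mul, enorm_mul]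
    gcongr
    rw [← ofReal_norm, ← ofReal_norm]
    refine ENNReal.ofReal_le_ofReal ?_
    rw [Complex.norm_real, Real.norm_eq_abs]
    simpa using Complex.abs_im_le_norm ((φ x : ℂ) - z)
  · rw [Ring.inverse_non_unit _ hu]
    rw [zero_apply, smul_zero]
    filter_upwards [Lp.coeFn_zero ℂ 2 (volume.restrict (Ioo 0 ω))] with x hx
    rw [hx]
    simp

theorem stmt_13 (ω : ℝ) (hω : 0 < ω) (β : ℝ) (hβ : 0 < β) (C : ℝ)
    (E : ℝ → ℝ)
    (hE : ∀ x : ℝ, 0 < x →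
      E x = ∫ s in Ioi (0 : ℝ),
        (1 / Real.Gamma s) * Real.exp (-C * s) * s ^ (β - 1) * x ^ (s - 1))
    (φ : ℝ → ℝ) (hφmeas : Measurable φ) (hφbdd : ∃ K : ℝ, ∀ x ∈ Ioo (0 : ℝ) ω, |φ x| ≤ K)
    (S Vβ : Lp ℂ 2 (volume.restrict (Ioo 0 ω)) →L[ℂ] Lp ℂ 2 (volume.restrict (Ioo 0 ω)))
    (hS : ∀ f : Lp ℂ 2 (volume.restrict (Ioo 0 ω)),
      (⇑(S f) : ℝ → ℂ) =ᵐ[volume.restrict (Ioo 0 ω)] fun x : ℝ => (φ x : ℂ) * f x)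
    (hV : ∀ f : Lp ℂ 2 (volume.restrict (Ioo 0 ω)),
      (⇑(Vβ f) : ℝ → ℂ) =ᵐ[volume.restrict (Ioo 0 ω)]
        fun x : ℝ => (1 / Real.Gamma β : ℝ) • ∫ t in Ioo (0 : ℝ) x, (E (x - t) : ℂ) * f t)
    (c : ℕ → ℂ → (Lp ℂ 2 (volume.restrict (Ioo 0 ω)) →L[ℂ] Lp ℂ 2 (volume.restrict (Ioo 0 ω))))
    (hc : ∀ (n : ℕ) (z : ℂ),
      c n z = (-((z.im : ℂ) • (Ring.inverse (S - algebraMap ℂ _ z) * Vβ))) ^ n)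
    (r : ℕ → ℝ → ℝ)
    (hr : ∀ (n : ℕ) (y : ℝ),
      r n y = ⨆ x : ℝ, ‖c n ((x : ℂ) + (y : ℂ) * Complex.I)‖ ^ ((1 : ℝ) / n)) :
    ∃ C₁ > (0 : ℝ), ∃ δ > (0 : ℝ), ∀ y : ℝ, 0 < |y| → |y| ≤ δ →
      {n : ℕ | 1 ≤ n ∧ |y| / 2 < r n y}.Finite ∧
      (1 ≤ {n : ℕ | 1 ≤ n ∧ |y| / 2 < r n y}.ncard →
        Real.log {n : ℕ | 1 ≤ n ∧ |y| / 2 < r n y}.ncard ≤ C₁ * (1 / |y|) ^ ((1 : ℝ) / β)) := by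
  obtain ⟨K, hK⟩ : ∃ K : ℝ, K = (2 * Real.exp ω) ^ (1 / β) := ⟨_, rfl⟩
  have hK0 : 0 < K := hK ▸ by positivity
  have hrn : ∀ (n : ℕ) (y : ℝ), 1 ≤ n → 0 < C + Real.log n →
      r n y ≤ Real.exp ω * (1 / (C + Real.log n)) ^ β := by
    intro n y hn hpos
    have hn0 : (0 : ℝ) < n := by exact_mod_cast hn
    rw [hr]
    refine Real.iSup_le (fun x => ?_) (by positivity)
    set z : ℂ := (x : ℂ) + (y : ℂ) * Complex.I
    have hc' := norm_pow_le_of_weightedSq_le (ω := ω) hn0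
      (a := (1 / (C + Real.log n)) ^ β) (by positivity)
      (T := -((z.im : ℂ) • (Ring.inverse (S - algebraMap ℂ _ z) * Vβ))) (fun f => by
        refine le_trans (weightedSq_mono_ae (g := Vβ f) ?_) (le_trans (weightedSq_mono_ae ?_)
          (weightedSq_volterra_le (β := β) (C := C) hβ hn0 hpos hE (Lp.aestronglyMeasurable f)))
        · filter_upwards [enorm_smul_resolvent_le hS z (Vβ f),
            Lp.coeFn_neg ((z.im : ℂ) • Ring.inverse (S - algebraMap ℂ _ z) (Vβ f))] with x h1 h2
          refine le_trans (le_of_eq ?_) h1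
          exact (congrArg _ h2).trans (enorm_neg _)
        · filter_upwards [hV f] with x hx
          rw [hx]) n
    rw [← hc] at hc'
    calc _ ≤ (Real.exp (n * ω) * ((1 / (C + Real.log n)) ^ β) ^ n) ^ ((1 : ℝ) / n) :=
          Real.rpow_le_rpow (norm_nonneg _) hc' (by positivity)
      _ = _ := by
        rw [Real.exp_nat_mul, ← mul_pow, one_div (n : ℝ),
          Real.pow_rpow_inv_natCast (by positivity) (by omega)]
  refine ⟨|C| + K, by positivity, 1, one_pos, fun y hy hy1 => ?_⟩
  set t : ℝ := (1 / |y|) ^ ((1 : ℝ) / β)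
  have ht : 1 ≤ t := Real.one_le_rpow (by rwa [le_div_iff₀ hy, one_mul]) (by positivity)
  have hsub : {n : ℕ | 1 ≤ n ∧ |y| / 2 < r n y} ⊆ Finset.Icc 1 ⌊Real.exp ((|C| + K) * t)⌋₊ := by
    rintro n ⟨hn, hlt⟩
    have hn0 : (0 : ℝ) < n := by exact_mod_cast hn
    rw [Finset.coe_Icc, mem_Icc]
    refine ⟨hn, Nat.le_floor ?_⟩
    rw [← Real.log_le_iff_le_exp hn0]
    have hCt : |C| ≤ |C| * t := le_mul_of_one_le_right (abs_nonneg C) ht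
    have hKt : 0 < K * t := by positivity
    have hC := neg_abs_le C
    rcases le_or_gt (C + Real.log n) 0 with h | h
    · linarith
    · have h1 := hlt.trans_le (hrn n y hn h)
      rw [one_div, Real.inv_rpow h.le, ← div_eq_mul_inv, lt_div_iff₀ (by positivity)] at h1
      have h2 : (C + Real.log n) ^ β ≤ 2 * Real.exp ω * (1 / |y|) := by
        rw [mul_one_div, le_div_iff₀ hy]
        linarith
      have h3 := Real.rpow_le_rpow (by positivity) h2 (by positivity : 0 ≤ 1 / β)
      rw [Real.mul_rpow (by positivity) (by positivity), ← hK, ← Real.rpow_mul h.le,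
        mul_one_div_cancel hβ.ne', Real.rpow_one] at h3
      linarith
  refine ⟨(Finset.finite_toSet _).subset hsub, fun hcard => ?_⟩
  rw [Real.log_le_iff_le_exp (by exact_mod_cast hcard)]
  have h := Set.ncard_le_ncard hsub (Finset.finite_toSet _)
  rw [Set.ncard_coe_finset, Nat.card_Icc, Nat.add_sub_cancel] at h
  exact (Nat.le_floor_iff (Real.exp_pos _).le).1 h
end
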